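/- Let H be a complex separable Hilbert space and let A = L + iB, where L is a bounded self-adjoint operator on H and B is a self-adjoint Hilbert–Schmidt operator on H. Then A belongs to the class T: for every pair of closed subspaces H₁ ⊆ H₂ of H, each invariant under A, with dim(H₂ ⊖ H₁) > 1, there exists a closed subspace H₃ invariant under A with H₁ ⊆ H₃ ⊆ H₂, H₃ ≠ H₁, and H₃ ≠ H₂. -/

import Mathlib

section Schur

variable {E : Type*} [NormedAddCommGroup E] [InnerProductSpace ℂ E]

/-- A finite-dimensional compression has an eigenvector whose eigenvalue has minimal modulus. -/
theorem exists_minimal_compression_eigenvector (A : E →L[ℂ] E) (V : Submodule ℂ E)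
    [FiniteDimensional ℂ V] [Nontrivial V] :
    ∃ l : ℂ, ∃ v ∈ V, ‖v‖ = 1 ∧ (∀ u ∈ V, inner ℂ u (A v) = l * inner ℂ u v) ∧
      ∀ m : ℂ, ∀ w ∈ V, w ≠ 0 → (∀ u ∈ V, inner ℂ u (A w) = m * inner ℂ u w) → ‖l‖ ≤ ‖m‖ := by
  let T : Module.End ℂ V :=
    ((V.orthogonalProjectionOnto ∘L A ∘L V.subtypeL : V →L[ℂ] V) : V →ₗ[ℂ] V)
  have hT (u w : V) : inner ℂ u (T w) = inner ℂ (u : E) (A w) := by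
    change inner ℂ u (V.orthogonalProjectionOnto (A w)) = _
    rw [Submodule.inner_orthogonalProjectionOnto_eq_of_mem_left]
  obtain ⟨l, hl, hmin⟩ := Set.exists_min_image {m | T.HasEigenvalue m} (fun m => ‖m‖)
    T.finite_hasEigenvalue (Module.End.exists_eigenvalue T)
  obtain ⟨v, hv⟩ := hl.exists_hasEigenvector
  have hv0 : ‖(v : E)‖ ≠ 0 := norm_ne_zero_iff.2 (by simpa using hv.2)
  refine ⟨l, ((‖v‖⁻¹ : ℂ) • v : V), Submodule.coe_mem _, ?_, fun u hu => ?_, fun m w hw hw0 h => ?_⟩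
  · simp only [Submodule.coe_smul, norm_smul, norm_inv, Complex.norm_real, norm_norm,
      Submodule.coe_norm]
    exact inv_mul_cancel₀ hv0
  · have h1 := hT ⟨u, hu⟩ v
    rw [hv.apply_eq_smul, inner_smul_right] at h1
    simp only [Submodule.coe_smul, map_smul, inner_smul_right, ← h1]
    simp only [Submodule.coe_inner]
    ring
  · refine hmin m (Module.End.hasEigenvalue_of_hasEigenvector (x := ⟨w, hw⟩) ⟨?_, ?_⟩)
    · rw [Module.End.mem_eigenspace_iff]
      refine ext_inner_left ℂ fun u => ?_
      rw [hT, h u u.2, inner_smul_right, Submodule.coe_inner]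
    · simpa [Subtype.ext_iff] using hw0

/-- Schur triangularization of a compression, with diagonal entries of increasing modulus. -/
theorem exists_ordered_schur_basis (A : E →L[ℂ] E) (n : ℕ) :
    ∀ (V : Submodule ℂ E) [FiniteDimensional ℂ V], Module.finrank ℂ V = n →
      ∃ v : Fin n → E, Orthonormal ℂ v ∧ Submodule.span ℂ (Set.range v) = V ∧
        (∀ i j, j < i → inner ℂ (v i) (A (v j)) = 0) ∧
        Monotone fun i => ‖inner ℂ (v i) (A (v i))‖ := by
  induction n with
  | zero =>
    intro V _ hV
    refine ⟨Fin.elim0, ⟨fun i => i.elim0, fun i => i.elim0⟩, ?_, fun i => i.elim0, fun i => i.elim0⟩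
    rw [Submodule.finrank_eq_zero] at hV
    simp [hV]
  | succ n ih =>
    intro V _ hV
    have : Nontrivial V := Module.nontrivial_of_finrank_eq_succ hV
    obtain ⟨l, v₀, hv₀, hnorm, hl, hmin⟩ := exists_minimal_compression_eigenvector A V
    have hv₀0 : v₀ ≠ 0 := by rintro rfl; simp at hnorm
    have hspan : Submodule.span ℂ {v₀} ≤ V := by simpa using hv₀
    have hfin : Module.finrank ℂ ((Submodule.span ℂ {v₀})ᗮ ⊓ V : Submodule ℂ E) = n :=
      Submodule.finrank_add_inf_finrank_orthogonal' hspan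
        (by rw [finrank_span_singleton hv₀0, hV, add_comm])
    obtain ⟨w, hw, hwspan, htri, hmono⟩ := ih ((Submodule.span ℂ {v₀})ᗮ ⊓ V) hfin
    have hwmem (i) : w i ∈ (Submodule.span ℂ {v₀})ᗮ ⊓ V :=
      hwspan ▸ Submodule.subset_span (Set.mem_range_self i)
    have hwv (i) : inner ℂ v₀ (w i) = 0 :=
      Submodule.mem_orthogonal_singleton_iff_inner_right.1 (hwmem i).1
    have hd : inner ℂ v₀ (A v₀) = l := by
      rw [hl v₀ hv₀, inner_self_eq_norm_sq_to_K, hnorm]; simp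
    have hle : V ≤ Submodule.span ℂ {v₀} ⊔ ((Submodule.span ℂ {v₀})ᗮ ⊓ V) := by
      rw [Submodule.sup_orthogonal_inf_of_hasOrthogonalProjection hspan]
    refine ⟨Fin.cons v₀ w, ?_, ?_, ?_, ?_⟩
    · rw [orthonormal_iff_ite] at hw ⊢
      intro i j
      refine Fin.cases ?_ (fun i => ?_) i <;> refine Fin.cases ?_ (fun j => ?_) j
      · simp [inner_self_eq_norm_sq_to_K, hnorm]
      · simpa [(Fin.succ_ne_zero j).symm] using hwv j
      · simpa [Fin.succ_ne_zero i] using inner_eq_zero_symm.1 (hwv i)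
      · simpa using hw i j
    · rw [Fin.range_cons, Submodule.span_insert, hwspan]
      exact le_antisymm (sup_le hspan inf_le_right) hle
    · intro i j
      refine Fin.cases ?_ (fun i => ?_) i <;> refine Fin.cases ?_ (fun j => ?_) j
      · simp
      · simp
      · intro _
        simp [hl _ (hwmem i).2, inner_eq_zero_symm.1 (hwv i)]
      · simpa using htri i j
    · rw [Fin.monotone_iff_le_succ]
      intro i
      cases n with
      | zero => exact i.elim0
      | succ n =>
      refine Fin.cases ?_ (fun i => ?_) i
      · change ‖inner ℂ v₀ (A v₀)‖ ≤ ‖inner ℂ (w 0) (A (w 0))‖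
        rw [hd]
        set m := inner ℂ (w 0) (A (w 0)) with hm
        have hw0 : inner ℂ (w 0) (w 0) = (1 : ℂ) := by
          rw [inner_self_eq_norm_sq_to_K, hw.1]; simp
        have heig (u) (hu : u ∈ (Submodule.span ℂ {v₀})ᗮ ⊓ V) :
            inner ℂ u (A (w 0)) = m * inner ℂ u (w 0) := by
          rw [← hwspan] at hu
          induction hu using Submodule.span_induction with
          | mem x hx =>
            obtain ⟨i, rfl⟩ := hx
            rcases eq_or_ne i 0 with rfl | hi
            · rw [hw0, mul_one]
            · rw [htri i 0 (Fin.pos_of_ne_zero hi), hw.2 hi, mul_zero]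
          | zero => simp
          | add x y _ _ hx hy => simp only [inner_add_left, hx, hy]; ring
          | smul a x _ hx => simp only [inner_smul_left, hx]; ring
        by_cases hml : m = l
        · rw [hml]
        set a := inner ℂ v₀ (A (w 0)) with ha
        refine hmin m (w 0 + (a / (m - l)) • v₀)
          (V.add_mem (hwmem 0).2 (V.smul_mem _ hv₀)) (fun h => ?_) (fun u hu => ?_)
        · have := congrArg (inner ℂ (w 0)) h
          rw [inner_add_right, inner_smul_right, hw0, inner_eq_zero_symm.1 (hwv 0)] at this
          simp at this
        · obtain ⟨x, hx, y, hy, rfl⟩ := Submodule.mem_sup.1 (hle hu)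
          obtain ⟨b, rfl⟩ := Submodule.mem_span_singleton.1 hx
          have hyv : inner ℂ y v₀ = 0 :=
            inner_eq_zero_symm.1 (Submodule.mem_orthogonal_singleton_iff_inner_right.1 hy.1)
          have hml' : m - l ≠ 0 := sub_ne_zero.2 hml
          simp only [map_add, map_smul, inner_add_left, inner_add_right, inner_smul_left,
            inner_smul_right, heig y hy, hl y hy.2, hl v₀ hv₀, ← ha, hyv, hwv,
            inner_self_eq_norm_sq_to_K, hnorm]
          simp
          field_simp
          ring
      · exact hmono (Fin.castSucc_le_succ i)

end Schur

section Diagonal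

variable {E : Type*} [NormedAddCommGroup E] [InnerProductSpace ℂ E] {N : ℕ}

/-- The operator `x ↦ ∑ i, c i ⟪v i, x⟫ v i`. -/
noncomputable def diagonalOperator (v : Fin N → E) (c : Fin N → ℂ) : E →L[ℂ] E :=
  ∑ i, (innerSL ℂ (v i)).smulRight (c i • v i)

theorem diagonalOperator_apply (v : Fin N → E) (c : Fin N → ℂ) (x : E) :
    diagonalOperator v c x = ∑ i, (c i * inner ℂ (v i) x) • v i := by
  simp [diagonalOperator, smul_smul, mul_comm]

theorem diagonalOperator_congr (v : Fin N → E) {c c' : Fin N → ℂ} {x y : E}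
    (h : ∀ i, c i * inner ℂ (v i) x = c' i * inner ℂ (v i) y) :
    diagonalOperator v c x = diagonalOperator v c' y := by
  simp only [diagonalOperator_apply, h]

theorem diagonalOperator_sub_apply (v : Fin N → E) (c c' : Fin N → ℂ) (x : E) :
    diagonalOperator v c x - diagonalOperator v c' x = diagonalOperator v (c - c') x := by
  simp [diagonalOperator_apply, ← Finset.sum_sub_distrib, sub_mul, sub_smul]

theorem inner_diagonalOperator_left (v : Fin N → E) (c : Fin N → ℂ) (x y : E) :
    inner ℂ (diagonalOperator v c x) y = inner ℂ x (diagonalOperator v (star c) y) := by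
  simp only [diagonalOperator_apply, sum_inner, inner_sum, inner_smul_left, inner_smul_right,
    map_mul, inner_conj_symm, Pi.star_apply, RCLike.star_def]
  exact Finset.sum_congr rfl fun i _ => by ring

variable {v : Fin N → E}

theorem inner_diagonalOperator (hv : Orthonormal ℂ v) (c : Fin N → ℂ) (x : E) (i : Fin N) :
    inner ℂ (v i) (diagonalOperator v c x) = c i * inner ℂ (v i) x := by
  rw [diagonalOperator_apply, hv.inner_right_fintype]

theorem diagonalOperator_diagonalOperator (hv : Orthonormal ℂ v) (c c' : Fin N → ℂ) (x : E) :
    diagonalOperator v c (diagonalOperator v c' x) = diagonalOperator v (c * c') x :=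
  diagonalOperator_congr v fun i => by rw [inner_diagonalOperator hv, Pi.mul_apply, mul_assoc]

theorem norm_sq_diagonalOperator (hv : Orthonormal ℂ v) (c : Fin N → ℂ) (x : E) :
    ‖diagonalOperator v c x‖ ^ 2 = ∑ i, ‖c i‖ ^ 2 * ‖inner ℂ (v i) x‖ ^ 2 := by
  have h := inner_self_eq_norm_sq_to_K (𝕜 := ℂ) (diagonalOperator v c x)
  rw [diagonalOperator_apply, hv.inner_sum] at h
  rw [diagonalOperator_apply]
  apply Complex.ofReal_injective
  push_cast
  refine h.symm.trans (Finset.sum_congr rfl fun i _ => ?_)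
  rw [RCLike.conj_mul, norm_mul]
  simp [mul_pow]

theorem norm_diagonalOperator_le_mul (hv : Orthonormal ℂ v) {c c' : Fin N → ℂ} {r : ℝ} (hr : 0 ≤ r)
    (h : ∀ i, ‖c i‖ ≤ r * ‖c' i‖) (x : E) :
    ‖diagonalOperator v c x‖ ≤ r * ‖diagonalOperator v c' x‖ := by
  refine le_of_sq_le_sq ?_ (by positivity)
  rw [mul_pow, norm_sq_diagonalOperator hv, norm_sq_diagonalOperator hv, Finset.mul_sum]
  refine Finset.sum_le_sum fun i _ => ?_
  have := mul_le_mul_of_nonneg_right (pow_le_pow_left₀ (norm_nonneg _) (h i) 2)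
    (sq_nonneg ‖inner ℂ (v i) x‖)
  rwa [mul_pow, mul_assoc] at this

theorem norm_diagonalOperator_le (hv : Orthonormal ℂ v) {c c' : Fin N → ℂ}
    (h : ∀ i, ‖c i‖ ≤ ‖c' i‖) (x : E) :
    ‖diagonalOperator v c x‖ ≤ ‖diagonalOperator v c' x‖ := by
  simpa using norm_diagonalOperator_le_mul hv zero_le_one (by simpa using h) x

theorem norm_diagonalOperator_le_norm (hv : Orthonormal ℂ v) {c : Fin N → ℂ} {r : ℝ} (hr : 0 ≤ r)
    (h : ∀ i, ‖c i‖ ≤ r)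
    (x : E) : ‖diagonalOperator v c x‖ ≤ r * ‖x‖ := by
  refine (norm_diagonalOperator_le_mul hv (c' := 1) hr (by simpa using h) x).trans ?_
  refine mul_le_mul_of_nonneg_left ?_ hr
  refine le_of_sq_le_sq ?_ (norm_nonneg _)
  simpa [norm_sq_diagonalOperator hv] using hv.sum_inner_products_le x (s := Finset.univ)

theorem diagonalOperator_one_eq_starProjection (hv : Orthonormal ℂ v)
    (V : Submodule ℂ E) [V.HasOrthogonalProjection]
    (hV : Submodule.span ℂ (Set.range v) = V) (x : E) :
    diagonalOperator v 1 x = V.starProjection x := by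
  refine (Submodule.eq_starProjection_of_mem_of_inner_eq_zero ?_ fun w hw => ?_).symm
  · rw [diagonalOperator_apply, ← hV]
    exact Submodule.sum_mem _ fun i _ =>
      Submodule.smul_mem _ _ (Submodule.subset_span (Set.mem_range_self i))
  · rw [← hV] at hw
    rw [← inner_conj_symm, map_eq_zero]
    induction hw using Submodule.span_induction with
    | mem x hx =>
      obtain ⟨i, rfl⟩ := hx
      rw [inner_sub_right, inner_diagonalOperator hv]
      simp
    | zero => simp
    | add x y _ _ hx hy => rw [inner_add_left, hx, hy, add_zero]
    | smul a x _ hx => rw [inner_smul_left, hx, mul_zero]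

end Diagonal

section Weights

/-- Weights which make a strictly triangular matrix with given row norms small. -/
theorem exists_triangular_weights {N : ℕ} (a : Fin N → ℝ) (ha : ∀ i, 0 ≤ a i) {e : ℝ}
    (he : 0 < e) :
    ∃ W : Fin N → ℝ, (∀ i, 1 ≤ W i) ∧ (∀ i, W i ≤ Real.exp ((∑ i, a i) / e)) ∧
      ∀ j, ∑ i ∈ Finset.Iio j, a i * W i ≤ e * W j := by
  have hfac (i : Fin N) : 1 ≤ 1 + a i / e := by
    have := div_nonneg (ha i) he.le
    linarith
  refine ⟨fun j => ∏ i ∈ Finset.Iio j, (1 + a i / e), fun j => ?_, fun j => ?_, fun j => ?_⟩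
  · exact Finset.one_le_prod fun i _ => hfac i
  · calc ∏ i ∈ Finset.Iio j, (1 + a i / e) ≤ ∏ i, (1 + a i / e) :=
          Finset.prod_le_prod_of_subset_of_one_le (Finset.subset_univ _)
            (fun i _ => zero_le_one.trans (hfac i)) fun i _ _ => hfac i
      _ ≤ ∏ i, Real.exp (a i / e) := Finset.prod_le_prod
          (fun i _ => zero_le_one.trans (hfac i)) fun i _ => by
            rw [add_comm]; exact Real.add_one_le_exp _
      _ = Real.exp ((∑ i, a i) / e) := by rw [← Real.exp_sum, Finset.sum_div]
  · have key : ∏ i ∈ Finset.Iio j, (1 + a i / e) =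
        1 + ∑ i ∈ Finset.Iio j, a i / e * ∏ k ∈ Finset.Iio j with k < i, (1 + a k / e) := 
      Finset.prod_one_add_ordered _ _
    have hfilter (i) (hi : i ∈ Finset.Iio j) :
        (Finset.Iio j).filter (fun k => k < i) = Finset.Iio i := by
      ext k
      simp only [Finset.mem_filter, Finset.mem_Iio] at hi ⊢
      exact ⟨fun h => h.2, fun h => ⟨h.trans hi, h⟩⟩
    simp only
    rw [key, mul_add, Finset.mul_sum]
    refine (Finset.sum_le_sum fun i hi => ?_).trans (le_add_of_nonneg_left (by linarith))
    rw [hfilter i hi]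
    field_simp
    exact le_rfl

end Weights

section SchurFrame

variable {E : Type*} [NormedAddCommGroup E] [InnerProductSpace ℂ E] {N : ℕ}

/-- An orthonormal family in which `A` is upper triangular, with diagonal entries of increasing
modulus. -/
structure IsSchurFrame (A : E →L[ℂ] E) (v : Fin N → E) : Prop where
  orthonormal : Orthonormal ℂ v
  triangular : ∀ i j, j < i → inner ℂ (v i) (A (v j)) = 0
  monotone : Monotone fun i => ‖inner ℂ (v i) (A (v i))‖

/-- The compression of `A` to the span of `v`, extended by zero. -/
noncomputable def compression (A : E →L[ℂ] E) (v : Fin N → E) : E →L[ℂ] E :=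
  diagonalOperator v 1 ∘L A ∘L diagonalOperator v 1

/-- The indicator of the diagonal entries of modulus at most `c`. -/
noncomputable def cutoffSymbol (A : E →L[ℂ] E) (v : Fin N → E) (c : ℝ) : Fin N → ℂ :=
  open Classical in fun i => if ‖inner ℂ (v i) (A (v i))‖ ≤ c then 1 else 0

/-- The projection onto the span of the vectors whose diagonal entry has modulus at most `c`. -/
noncomputable def cutoff (A : E →L[ℂ] E) (v : Fin N → E) (c : ℝ) : E →L[ℂ] E :=
  diagonalOperator v (cutoffSymbol A v c)

theorem cutoffSymbol_eq (A : E →L[ℂ] E) (v : Fin N → E) (c : ℝ) (i : Fin N) :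
    cutoffSymbol A v c i = 1 ∧ ‖inner ℂ (v i) (A (v i))‖ ≤ c ∨
      cutoffSymbol A v c i = 0 ∧ c < ‖inner ℂ (v i) (A (v i))‖ := by
  unfold cutoffSymbol
  split_ifs with h
  · exact Or.inl ⟨rfl, h⟩
  · exact Or.inr ⟨rfl, not_le.1 h⟩

theorem sub_cutoff_apply (A : E →L[ℂ] E) (v : Fin N → E) (c : ℝ) (x : E) :
    diagonalOperator v 1 x - cutoff A v c x = diagonalOperator v (1 - cutoffSymbol A v c) x :=
  diagonalOperator_sub_apply _ _ _ _

namespace IsSchurFrame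

variable {A : E →L[ℂ] E} {v : Fin N → E}

theorem inner_compression (h : IsSchurFrame A v) (x : E) (i : Fin N) :
    inner ℂ (v i) (compression A v x) = ∑ j, inner ℂ (v i) (A (v j)) * inner ℂ (v j) x := by
  rw [compression, ContinuousLinearMap.comp_apply, ContinuousLinearMap.comp_apply,
    inner_diagonalOperator h.orthonormal, diagonalOperator_apply]
  simp [mul_comm]

theorem diagonalOperator_one_compression (h : IsSchurFrame A v) (x : E) :
    diagonalOperator v 1 (compression A v x) = compression A v x := by
  simp [compression, diagonalOperator_diagonalOperator h.orthonormal]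

theorem compression_diagonalOperator_one (h : IsSchurFrame A v) (x : E) :
    compression A v (diagonalOperator v 1 x) = compression A v x := by
  simp [compression, diagonalOperator_diagonalOperator h.orthonormal]

theorem cutoff_compression_cutoff (h : IsSchurFrame A v) (c : ℝ) (x : E) :
    cutoff A v c (compression A v (cutoff A v c x)) = compression A v (cutoff A v c x) := by
  rw [← h.diagonalOperator_one_compression (cutoff A v c x)]
  rw [cutoff, diagonalOperator_diagonalOperator h.orthonormal]
  refine diagonalOperator_congr v fun i => ?_
  rcases cutoffSymbol_eq A v c i with hi | hi
  · simp [hi.1]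
  · rw [h.inner_compression, Finset.sum_eq_zero]
    · simp
    intro j _
    rcases lt_or_ge j i with hj | hj
    · rw [h.triangular i j hj, zero_mul]
    · rcases cutoffSymbol_eq A v c j with hj' | hj'
      · exact absurd (hi.2.trans_le (h.monotone hj)) (not_lt.2 hj'.2)
      · rw [inner_diagonalOperator h.orthonormal, hj'.1]
        simp

theorem diagonalOperator_one_sub_compression (h : IsSchurFrame A v) (c : ℝ) (x : E) :
    diagonalOperator v (1 - cutoffSymbol A v c) (compression A v x) =
      diagonalOperator v (1 - cutoffSymbol A v c) (compression A v
        (diagonalOperator v (1 - cutoffSymbol A v c) x)) := by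
  conv_rhs => rw [← sub_cutoff_apply A v c x, map_sub, h.compression_diagonalOperator_one, map_sub,
    ← h.cutoff_compression_cutoff, cutoff, diagonalOperator_diagonalOperator h.orthonormal]
  have : (1 - cutoffSymbol A v c) * cutoffSymbol A v c = 0 := by
    funext i
    rcases cutoffSymbol_eq A v c i with hi | hi <;> simp [hi.1]
  rw [this]
  simp [diagonalOperator_apply]

theorem exists_weights (h : IsSchurFrame A v) {C e : ℝ} (he : 0 < e)
    (hC : ∑ i, ∑ j ∈ Finset.Ioi i, ‖inner ℂ (v i) (A (v j))‖ ^ 2 ≤ C) :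
    ∃ w : Fin N → ℂ, (∀ i, 1 ≤ ‖w i‖) ∧ (∀ i, ‖w i‖ ≤ Real.exp (C / e ^ 2)) ∧
      ∀ x, ‖diagonalOperator v w (compression A v x -
        diagonalOperator v (fun i => inner ℂ (v i) (A (v i))) x)‖ ≤
          e * ‖diagonalOperator v w x‖ := by
  obtain ⟨W, hW1, hW2, hW3⟩ := exists_triangular_weights
    (fun i => ∑ j ∈ Finset.Ioi i, ‖inner ℂ (v i) (A (v j))‖ ^ 2)
    (fun i => Finset.sum_nonneg fun j _ => sq_nonneg _) (sq_pos_of_pos he)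
  have hnorm (i) : ‖((√(W i) : ℝ) : ℂ)‖ = √(W i) := by
    rw [Complex.norm_real, Real.norm_of_nonneg (Real.sqrt_nonneg _)]
  have hW0 (i) : 0 ≤ W i := zero_le_one.trans (hW1 i)
  refine ⟨fun i => (√(W i) : ℝ), fun i => ?_, fun i => ?_, fun x => ?_⟩
  · rw [hnorm]
    exact Real.one_le_sqrt.2 (hW1 i)
  · rw [hnorm]
    calc √(W i) ≤ W i := Real.sqrt_le_iff.2 ⟨hW0 i, by nlinarith [hW1 i]⟩
      _ ≤ _ := hW2 i
      _ ≤ _ := by gcongr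
  · refine le_of_sq_le_sq ?_ (by positivity)
    rw [mul_pow, norm_sq_diagonalOperator h.orthonormal, norm_sq_diagonalOperator h.orthonormal]
    have hcoord (i) : inner ℂ (v i) (compression A v x -
        diagonalOperator v (fun i => inner ℂ (v i) (A (v i))) x) =
          ∑ j ∈ Finset.Ioi i, inner ℂ (v i) (A (v j)) * inner ℂ (v j) x := by
      rw [inner_sub_right, h.inner_compression, inner_diagonalOperator h.orthonormal,
        ← Finset.sum_subset (Finset.subset_univ (Finset.Ici i)),
        ← Finset.Ioi_insert, Finset.sum_insert (by simp), add_sub_cancel_left]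
      intro j _ hj
      rw [h.triangular i j (by simpa using hj), zero_mul]
    have hCS (i) : ‖∑ j ∈ Finset.Ioi i, inner ℂ (v i) (A (v j)) * inner ℂ (v j) x‖ ^ 2 ≤
        (∑ j ∈ Finset.Ioi i, ‖inner ℂ (v i) (A (v j))‖ ^ 2) *
          ∑ j ∈ Finset.Ioi i, ‖inner ℂ (v j) x‖ ^ 2 := by
      refine le_trans ?_ (Finset.sum_mul_sq_le_sq_mul_sq _ _ _)
      refine pow_le_pow_left₀ (norm_nonneg _) ((norm_sum_le _ _).trans_eq ?_) 2
      simp only [norm_mul]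
    simp only [hcoord, hnorm, Real.sq_sqrt (hW0 _)]
    calc ∑ i, W i * ‖∑ j ∈ Finset.Ioi i, inner ℂ (v i) (A (v j)) * inner ℂ (v j) x‖ ^ 2
        ≤ ∑ i, W i * ((∑ j ∈ Finset.Ioi i, ‖inner ℂ (v i) (A (v j))‖ ^ 2) *
          ∑ j ∈ Finset.Ioi i, ‖inner ℂ (v j) x‖ ^ 2) :=
          Finset.sum_le_sum fun i _ => mul_le_mul_of_nonneg_left (hCS i) (hW0 i)
      _ = ∑ i, ∑ j ∈ Finset.Ioi i, (∑ j ∈ Finset.Ioi i, ‖inner ℂ (v i) (A (v j))‖ ^ 2) * W i *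
            ‖inner ℂ (v j) x‖ ^ 2 := by
          refine Finset.sum_congr rfl fun i _ => ?_
          rw [← Finset.mul_sum]
          ring
      _ = ∑ j, ∑ i ∈ Finset.Iio j, (∑ j ∈ Finset.Ioi i, ‖inner ℂ (v i) (A (v j))‖ ^ 2) * W i *
            ‖inner ℂ (v j) x‖ ^ 2 := Finset.sum_comm' (by simp)
      _ ≤ ∑ j, e ^ 2 * W j * ‖inner ℂ (v j) x‖ ^ 2 := by
          refine Finset.sum_le_sum fun j _ => ?_
          rw [← Finset.sum_mul]
          exact mul_le_mul_of_nonneg_right (hW3 j) (sq_nonneg _)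
      _ = e ^ 2 * ∑ j, W j * ‖inner ℂ (v j) x‖ ^ 2 := by
          simp only [Finset.mul_sum, mul_assoc]

theorem norm_compression_pow_cutoff_le (h : IsSchurFrame A v) {C e : ℝ} (he : 0 < e)
    (hC : ∑ i, ∑ j ∈ Finset.Ioi i, ‖inner ℂ (v i) (A (v j))‖ ^ 2 ≤ C) {c : ℝ} (hc : 0 ≤ c)
    (k : ℕ) (x : E) :
    ‖(compression A v ^ k) (cutoff A v c x)‖ ≤ Real.exp (C / e ^ 2) * (c + e) ^ k * ‖x‖ := by
  obtain ⟨w, hw1, hw2, hw⟩ := h.exists_weights he hC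
  have hv := h.orthonormal
  have hidem (x : E) : cutoff A v c (cutoff A v c x) = cutoff A v c x := by
    rw [cutoff, diagonalOperator_diagonalOperator hv]
    congr 2
    funext i
    rcases cutoffSymbol_eq A v c i with hi | hi <;> simp [hi.1]
  have hstep (y : E) (hy : cutoff A v c y = y) :
      ‖diagonalOperator v w (compression A v y)‖ ≤ (c + e) * ‖diagonalOperator v w y‖ := by
    have h1 : ‖diagonalOperator v w (diagonalOperator v (fun i => inner ℂ (v i) (A (v i))) y)‖ ≤
        c * ‖diagonalOperator v w y‖ := by
      rw [← hy, cutoff]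
      simp only [diagonalOperator_diagonalOperator hv]
      refine norm_diagonalOperator_le_mul hv hc (fun i => ?_) y
      rcases cutoffSymbol_eq A v c i with hi | hi
      · simp only [Pi.mul_apply, norm_mul, hi.1, mul_one]
        rw [mul_comm]
        exact mul_le_mul_of_nonneg_right hi.2 (norm_nonneg _)
      · simp [hi.1]
    have h2 := norm_add_le
      (diagonalOperator v w (compression A v y -
        diagonalOperator v (fun i => inner ℂ (v i) (A (v i))) y))
      (diagonalOperator v w (diagonalOperator v (fun i => inner ℂ (v i) (A (v i))) y))
    rw [← map_add, sub_add_cancel] at h2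
    linarith [hw y]
  have hpow (k : ℕ) : cutoff A v c ((compression A v ^ k) (cutoff A v c x)) =
      (compression A v ^ k) (cutoff A v c x) ∧
      ‖diagonalOperator v w ((compression A v ^ k) (cutoff A v c x))‖ ≤
        (c + e) ^ k * ‖diagonalOperator v w (cutoff A v c x)‖ := by
    induction k with
    | zero => simp [hidem]
    | succ k ih =>
      rw [pow_succ' (compression A v), mul_apply_eq_comp]
      refine ⟨?_, (hstep _ ih.1).trans ?_⟩
      · rw [← ih.1, h.cutoff_compression_cutoff]
      · rw [pow_succ', mul_assoc]
        exact mul_le_mul_of_nonneg_left ih.2 (by positivity)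
  obtain ⟨h1, h2⟩ := hpow k
  calc ‖(compression A v ^ k) (cutoff A v c x)‖
      ≤ ‖diagonalOperator v w ((compression A v ^ k) (cutoff A v c x))‖ := by
        conv_lhs => rw [← h1, cutoff]
        refine norm_diagonalOperator_le hv (fun i => le_trans ?_ (hw1 i)) _
        rcases cutoffSymbol_eq A v c i with hi | hi <;> simp [hi.1]
    _ ≤ _ := h2
    _ ≤ (c + e) ^ k * (Real.exp (C / e ^ 2) * ‖x‖) := by
        refine mul_le_mul_of_nonneg_left ?_ (by positivity)
        rw [cutoff, diagonalOperator_diagonalOperator hv]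
        refine norm_diagonalOperator_le_norm hv (Real.exp_nonneg _) (fun i => ?_) x
        rcases cutoffSymbol_eq A v c i with hi | hi
        · simpa [hi.1] using hw2 i
        · simp [hi.1, Real.exp_nonneg]
    _ = _ := by ring

theorem norm_sub_cutoff_le (h : IsSchurFrame A v) {C e : ℝ} (he : 0 < e)
    (hC : ∑ i, ∑ j ∈ Finset.Ioi i, ‖inner ℂ (v i) (A (v j))‖ ^ 2 ≤ C) {c : ℝ} (hc : e ≤ c)
    (k : ℕ) (x : E) :
    (c - e) ^ k * ‖diagonalOperator v 1 x - cutoff A v c x‖ ≤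
      Real.exp (C / e ^ 2) * ‖(compression A v ^ k) x‖ := by
  obtain ⟨w, hw1, hw2, hw⟩ := h.exists_weights he hC
  have hv := h.orthonormal
  have hce : 0 ≤ c - e := sub_nonneg.2 hc
  set q := 1 - cutoffSymbol A v c with hq
  have hqi (i) : q i = 0 ∨ q i = 1 ∧ c ≤ ‖inner ℂ (v i) (A (v i))‖ := by
    rcases cutoffSymbol_eq A v c i with hi | hi
    · exact Or.inl (by simp [hq, hi.1])
    · exact Or.inr ⟨by simp [hq, hi.1], hi.2.le⟩
  have hqq : q * q = q := by
    funext i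
    rcases hqi i with hi | hi <;> simp [hi]
  have hstep (y : E) :
      (c - e) * ‖diagonalOperator v (w * q) y‖ ≤
        ‖diagonalOperator v (w * q) (compression A v y)‖ := by
    set D := diagonalOperator v (fun i => inner ℂ (v i) (A (v i))) with hD
    have h1 : c * ‖diagonalOperator v (w * q) y‖ ≤
        ‖diagonalOperator v (w * q) (D (diagonalOperator v q y))‖ := by
      have hc' : ‖(c : ℂ)‖ = c := by
        rw [Complex.norm_real, Real.norm_of_nonneg (he.le.trans hc)]
      have h0 : c * ‖diagonalOperator v (w * q) y‖ =
          ‖diagonalOperator v ((c : ℂ) • (w * q)) y‖ := by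
        have : diagonalOperator v ((c : ℂ) • (w * q)) y =
            (c : ℂ) • diagonalOperator v (w * q) y := by
          simp [diagonalOperator_apply, Finset.smul_sum, smul_smul, mul_assoc]
        rw [this, norm_smul, hc']
      rw [h0]
      simp only [hD, diagonalOperator_diagonalOperator hv]
      refine norm_diagonalOperator_le hv (fun i => ?_) y
      rcases hqi i with hi | hi
      · simp [hi]
      · simp only [Pi.smul_apply, Pi.mul_apply, norm_mul, hi.1, mul_one, smul_eq_mul,
          hc']
        rw [mul_comm]
        exact mul_le_mul_of_nonneg_left hi.2 (norm_nonneg _)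
    have h2 : ‖diagonalOperator v (w * q) (compression A v (diagonalOperator v q y) -
        D (diagonalOperator v q y))‖ ≤ e * ‖diagonalOperator v (w * q) y‖ := by
      rw [← diagonalOperator_diagonalOperator hv w q y]
      refine le_trans (norm_diagonalOperator_le hv (fun i => ?_) _) (hw _)
      rcases hqi i with hi | hi <;> simp [hi]
    have h3 : diagonalOperator v (w * q) (compression A v y) =
        diagonalOperator v (w * q) (compression A v (diagonalOperator v q y)) := by
      rw [← diagonalOperator_diagonalOperator hv, ← diagonalOperator_diagonalOperator hv w q,
        h.diagonalOperator_one_sub_compression]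
    have h4 := norm_sub_le
      (diagonalOperator v (w * q) (compression A v (diagonalOperator v q y)))
      (diagonalOperator v (w * q) (compression A v (diagonalOperator v q y) -
        D (diagonalOperator v q y)))
    rw [← map_sub, sub_sub_cancel, ← h3] at h4
    linarith
  have hpow (k : ℕ) : (c - e) ^ k * ‖diagonalOperator v (w * q) x‖ ≤
      ‖diagonalOperator v (w * q) ((compression A v ^ k) x)‖ := by
    induction k with
    | zero => simp
    | succ k ih =>
      rw [pow_succ' (compression A v), mul_apply_eq_comp, pow_succ', mul_assoc]
      exact (mul_le_mul_of_nonneg_left ih hce).trans (hstep _)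
  rw [sub_cutoff_apply]
  calc (c - e) ^ k * ‖diagonalOperator v q x‖
      ≤ (c - e) ^ k * ‖diagonalOperator v (w * q) x‖ := by
        refine mul_le_mul_of_nonneg_left (norm_diagonalOperator_le hv (fun i => ?_) x)
          (by positivity)
        rw [Pi.mul_apply, norm_mul]
        exact le_mul_of_one_le_left (norm_nonneg _) (hw1 i)
    _ ≤ _ := hpow k
    _ ≤ _ := by
        refine norm_diagonalOperator_le_norm hv (Real.exp_nonneg _) (fun i => ?_) _
        rcases hqi i with hi | hi
        · simp [hi, Real.exp_nonneg]
        · simpa [hi.1] using hw2 i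

end IsSchurFrame

end SchurFrame

section HilbertSchmidt

variable {E : Type*} [NormedAddCommGroup E] [InnerProductSpace ℂ E]

/-- The squared Hilbert–Schmidt norm of `T` is at most `C`, tested on finite orthonormal
families. -/
def HilbertSchmidtBound (T : E →L[ℂ] E) (C : ℝ) : Prop :=
  ∀ (m n : ℕ) (f : Fin m → E) (g : Fin n → E), Orthonormal ℂ f → Orthonormal ℂ g →
    ∑ i, ∑ j, ‖inner ℂ (f i) (T (g j))‖ ^ 2 ≤ C

theorem HilbertSchmidtBound.sum_norm_sq_le {T : E →L[ℂ] E} {C : ℝ} (hT : HilbertSchmidtBound T C)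
    {n : ℕ} {g : Fin n → E} (hg : Orthonormal ℂ g) : ∑ j, ‖T (g j)‖ ^ 2 ≤ C := by
  let V := Submodule.span ℂ (Set.range fun j => T (g j))
  have : FiniteDimensional ℂ V := FiniteDimensional.span_of_finite ℂ (Set.finite_range _)
  let b := stdOrthonormalBasis ℂ V
  have hb : Orthonormal ℂ fun i => (b i : E) :=
    b.orthonormal.comp_linearIsometry V.subtypeₗᵢ
  refine le_trans (le_of_eq ?_) (hT _ n _ g hb hg)
  rw [Finset.sum_comm]
  refine Finset.sum_congr rfl fun j _ => ?_
  have hj : T (g j) ∈ V := Submodule.subset_span (Set.mem_range_self j)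
  exact (b.sum_sq_norm_inner_right ⟨T (g j), hj⟩).symm

variable [CompleteSpace E]

theorem hilbertSchmidtBound_of_adjoint {T : E →L[ℂ] E} {C : ℝ}
    (h : ∀ (m : ℕ) (f : Fin m → E), Orthonormal ℂ f →
      ∑ i, ‖(ContinuousLinearMap.adjoint T) (f i)‖ ^ 2 ≤ C) : HilbertSchmidtBound T C := by
  intro m n f g hf hg
  refine le_trans (Finset.sum_le_sum fun i _ => ?_) (h m f hf)
  refine le_trans (le_of_eq ?_) (hg.sum_inner_products_le _ (s := Finset.univ))
  refine Finset.sum_congr rfl fun j _ => ?_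
  rw [← ContinuousLinearMap.adjoint_inner_left, norm_inner_symm]

theorem hilbertSchmidtBound_of_orthonormal {N : ℕ} {v : Fin N → E} (hv : Orthonormal ℂ v)
    {T : E →L[ℂ] E} {C : ℝ} (hT₁ : ∀ x, diagonalOperator v 1 (T x) = T x)
    (hT₂ : ∀ x, T (diagonalOperator v 1 x) = T x)
    (hC : ∑ i, ∑ j, ‖inner ℂ (v i) (T (v j))‖ ^ 2 ≤ C) : HilbertSchmidtBound T C := by
  refine hilbertSchmidtBound_of_adjoint fun m f hf => ?_
  have hadj (x : E) : ‖(ContinuousLinearMap.adjoint T) x‖ ^ 2 = ∑ j, ‖inner ℂ (T (v j)) x‖ ^ 2 := by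
    have : diagonalOperator v 1 ((ContinuousLinearMap.adjoint T) x) =
        (ContinuousLinearMap.adjoint T) x := by
      refine ext_inner_right ℂ fun y => ?_
      rw [inner_diagonalOperator_left, star_one, ContinuousLinearMap.adjoint_inner_left,
        ContinuousLinearMap.adjoint_inner_left, hT₂]
    rw [← this, norm_sq_diagonalOperator hv]
    simp [ContinuousLinearMap.adjoint_inner_right]
  simp only [hadj]
  rw [Finset.sum_comm]
  refine le_trans (Finset.sum_le_sum fun j _ => ?_) (Finset.sum_comm.trans_le hC)
  calc ∑ i, ‖inner ℂ (T (v j)) (f i)‖ ^ 2 = ∑ i, ‖inner ℂ (f i) (T (v j))‖ ^ 2 := by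
        simp only [norm_inner_symm]
    _ ≤ ‖T (v j)‖ ^ 2 := hf.sum_inner_products_le _ (s := Finset.univ)
    _ = ∑ i, ‖inner ℂ (v i) (T (v j))‖ ^ 2 := by
        rw [← hT₁ (v j), norm_sq_diagonalOperator hv]
        simp [hT₁]

theorem hilbertSchmidtBound_of_hilbertBasis {ι : Type*} (e : HilbertBasis ι ℂ E) {T : E →L[ℂ] E}
    (hT : Summable fun i => ‖T (e i)‖ ^ 2) : HilbertSchmidtBound T (∑' i, ‖T (e i)‖ ^ 2) := by
  refine hilbertSchmidtBound_of_adjoint fun m f hf => ?_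
  have hadj (x : E) : HasSum (fun i => ‖inner ℂ (T (e i)) x‖ ^ 2)
      (‖(ContinuousLinearMap.adjoint T) x‖ ^ 2) := by
    have := e.hasSum_inner_mul_inner ((ContinuousLinearMap.adjoint T) x)
      ((ContinuousLinearMap.adjoint T) x)
    rw [inner_self_eq_norm_sq_to_K] at this
    have h2 (i : ι) : inner ℂ ((ContinuousLinearMap.adjoint T) x) (e i) *
        inner ℂ (e i) ((ContinuousLinearMap.adjoint T) x) =
          ((‖inner ℂ (T (e i)) x‖ ^ 2 : ℝ) : ℂ) := by
      rw [ContinuousLinearMap.adjoint_inner_left, ContinuousLinearMap.adjoint_inner_right,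
        ← inner_conj_symm x, Complex.conj_mul', Complex.ofReal_pow]
    simp only [h2] at this
    rw [← Complex.hasSum_ofReal, Complex.ofReal_pow]
    exact this
  refine hasSum_le (fun i => ?_) (hasSum_sum fun a _ => hadj (f a)) hT.hasSum
  refine le_trans (le_of_eq ?_) (hf.sum_inner_products_le (T (e i)) (s := Finset.univ))
  simp only [norm_inner_symm]

/-- Hilbert–Schmidt operators are compact. -/
theorem HilbertSchmidtBound.isCompactOperator {T : E →L[ℂ] E} {C : ℝ}
    (hT : HilbertSchmidtBound T C) : IsCompactOperator T := by
  have key (e : ℝ) (he : 0 < e) : ∃ S : E →L[ℂ] E, IsCompactOperator S ∧ ‖S - T‖ ≤ e := by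
    let X : Set ℝ := {r | ∃ (n : ℕ) (g : Fin n → E), Orthonormal ℂ g ∧ ∑ j, ‖T (g j)‖ ^ 2 = r}
    have hX : BddAbove X := ⟨C, by rintro _ ⟨n, g, hg, rfl⟩; exact hT.sum_norm_sq_le hg⟩
    have hXne : X.Nonempty :=
      ⟨_, 0, Fin.elim0, ⟨fun i => i.elim0, fun i => i.elim0⟩, rfl⟩
    obtain ⟨_, ⟨n, g, hg, rfl⟩, hlt⟩ := exists_lt_of_lt_csSup hXne
      (sub_lt_self (sSup X) (sq_pos_of_pos he))
    have hperp (x : E) (hx : ∀ j, inner ℂ (g j) x = 0) : ‖T x‖ ≤ e * ‖x‖ := by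
      by_cases hx0 : x = 0
      · simp [hx0]
      have hxn : 0 < ‖x‖ := norm_pos_iff.2 hx0
      set u : E := ((‖x‖⁻¹ : ℝ) : ℂ) • x with hu
      have hun : ‖u‖ = 1 := by
        rw [hu, norm_smul, Complex.norm_real, norm_inv, norm_norm, inv_mul_cancel₀ hxn.ne']
      have hcons : Orthonormal ℂ (Fin.cons u g : Fin (n + 1) → E) := by
        rw [orthonormal_iff_ite] at hg ⊢
        intro i j
        refine Fin.cases ?_ (fun i => ?_) i <;> refine Fin.cases ?_ (fun j => ?_) j
        · simp [inner_self_eq_norm_sq_to_K, hun]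
        · simp [(Fin.succ_ne_zero j).symm, hu, inner_smul_left, inner_eq_zero_symm.1 (hx j)]
        · simp [Fin.succ_ne_zero i, hu, inner_smul_right, hx i]
        · simpa using hg i j
      have hle := le_csSup hX ⟨n + 1, Fin.cons u g, hcons, rfl⟩
      rw [Fin.sum_univ_succ] at hle
      simp only [Fin.cons_zero, Fin.cons_succ] at hle
      have hTu : ‖T u‖ ≤ e := le_of_sq_le_sq (by linarith) he.le
      have hTu' : ‖T u‖ = ‖x‖⁻¹ * ‖T x‖ := by
        rw [hu, map_smul, norm_smul, Complex.norm_real, norm_inv, norm_norm]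
      rw [hTu', inv_mul_le_iff₀ hxn] at hTu
      linarith
    refine ⟨T ∘L diagonalOperator g 1, ?_, ContinuousLinearMap.opNorm_le_bound _ he.le fun x => ?_⟩
    · have hmem (x : E) : diagonalOperator g 1 x ∈ Submodule.span ℂ (Set.range g) := by
        rw [diagonalOperator_apply]
        exact Submodule.sum_mem _ fun i _ =>
          Submodule.smul_mem _ _ (Submodule.subset_span (Set.mem_range_self i))
      have : FiniteDimensional ℂ (Submodule.span ℂ (Set.range g)) :=
        FiniteDimensional.span_of_finite ℂ (Set.finite_range _)
      have : ProperSpace (Submodule.span ℂ (Set.range g)) := FiniteDimensional.proper ℂ _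
      exact (isCompactOperator_of_locallyCompactSpace_rng
        (T ∘L (Submodule.span ℂ (Set.range g)).subtypeL)).comp_clm
          ((diagonalOperator g 1).codRestrict _ hmem)
    · have hx : (T ∘L diagonalOperator g 1 - T) x = -T (x - diagonalOperator g 1 x) := by
        simp
      rw [hx, norm_neg]
      refine (hperp _ fun j => ?_).trans (mul_le_mul_of_nonneg_left ?_ he.le)
      · rw [inner_sub_right, inner_diagonalOperator hg]
        simp
      · refine le_of_sq_le_sq ?_ (norm_nonneg _)
        have horth : inner ℂ (diagonalOperator g 1 x) (x - diagonalOperator g 1 x) = 0 := by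
          rw [inner_diagonalOperator_left, star_one, map_sub, diagonalOperator_diagonalOperator hg]
          simp
        have := norm_add_sq_eq_norm_sq_add_norm_sq_of_inner_eq_zero _ _ horth
        rw [add_sub_cancel] at this
        nlinarith [mul_self_nonneg ‖diagonalOperator g 1 x‖]
  choose S hS hST using fun n : ℕ => key (1 / (n + 1)) Nat.one_div_pos_of_nat
  refine isCompactOperator_of_tendsto (l := Filter.atTop) (F := S) ?_ (Filter.Eventually.of_forall hS)
  rw [tendsto_iff_norm_sub_tendsto_zero]
  exact squeeze_zero (fun _ => norm_nonneg _) hST tendsto_one_div_add_atTop_nhds_zero_nat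

end HilbertSchmidt

section FrameEstimates

variable {E : Type*} [NormedAddCommGroup E] [InnerProductSpace ℂ E] {N : ℕ}

theorem norm_sub_norm_le_two_mul_abs_im {z : ℂ} (hz : 0 ≤ z.re) : ‖z - ‖z‖‖ ≤ 2 * |z.im| := by
  have h1 : z - ‖z‖ = ((z.re - ‖z‖ : ℝ) : ℂ) + z.im * Complex.I := by
    apply Complex.ext <;> simp
  have h2 := Complex.norm_le_abs_re_add_abs_im z
  have h3 := Complex.re_le_norm z
  rw [abs_of_nonneg hz] at h2
  rw [h1]
  refine (norm_add_le _ _).trans ?_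
  rw [norm_mul, Complex.norm_I, Complex.norm_real, Complex.norm_real, Real.norm_eq_abs,
    Real.norm_eq_abs, abs_of_nonpos (by linarith)]
  linarith

/-- The operator whose eigenvalues are the moduli of the diagonal entries of `A`. -/
noncomputable def modulusDiagonal (A : E →L[ℂ] E) (v : Fin N → E) : E →L[ℂ] E :=
  diagonalOperator v fun i => (‖inner ℂ (v i) (A (v i))‖ : ℂ)

theorem cutoff_of_neg (A : E →L[ℂ] E) (v : Fin N → E) {c : ℝ} (hc : c < 0) (y : E) : cutoff A v c y = 0 := by
  have : cutoffSymbol A v c = 0 := by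
    funext i
    rcases cutoffSymbol_eq A v c i with hi | hi
    · linarith [hi.2, norm_nonneg (inner ℂ (v i) (A (v i)))]
    · exact hi.1
  simp [cutoff, this, diagonalOperator_apply]

namespace IsSchurFrame

variable {A : E →L[ℂ] E} {v : Fin N → E}

theorem norm_entry_le (h : IsSchurFrame A v) {B : E →L[ℂ] E}
    (hAB : ∀ x y, inner ℂ x (A y) - inner ℂ (A x) y = 2 * Complex.I * inner ℂ x (B y))
    {i j : Fin N} (hij : i < j) :
    ‖inner ℂ (v i) (A (v j))‖ = 2 * ‖inner ℂ (v i) (B (v j))‖ := by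
  have := hAB (v i) (v j)
  rw [inner_eq_zero_symm.1 (h.triangular j i hij), sub_zero] at this
  rw [this]
  simp

theorem sum_norm_sq_offDiagonal_le (h : IsSchurFrame A v) {B : E →L[ℂ] E} {C : ℝ}
    (hB : HilbertSchmidtBound B C)
    (hAB : ∀ x y, inner ℂ x (A y) - inner ℂ (A x) y = 2 * Complex.I * inner ℂ x (B y)) :
    ∑ i, ∑ j ∈ Finset.Ioi i, ‖inner ℂ (v i) (A (v j))‖ ^ 2 ≤ 4 * C := by
  refine le_trans ?_ (mul_le_mul_of_nonneg_left (hB _ _ v v h.orthonormal h.orthonormal) (by simp))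
  rw [Finset.mul_sum]
  refine Finset.sum_le_sum fun i _ => ?_
  rw [Finset.mul_sum]
  refine le_trans (Finset.sum_le_sum fun j hj => ?_)
    (Finset.sum_le_sum_of_subset_of_nonneg (Finset.subset_univ _) fun j _ _ => by positivity)
  rw [h.norm_entry_le hAB (Finset.mem_Ioi.1 hj)]
  exact le_of_eq (by ring)

theorem hilbertSchmidtBound_compression_sub (h : IsSchurFrame A v) [CompleteSpace E]
    {B : E →L[ℂ] E} {C : ℝ}
    (hB : HilbertSchmidtBound B C)
    (hAB : ∀ x y, inner ℂ x (A y) - inner ℂ (A x) y = 2 * Complex.I * inner ℂ x (B y))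
    (hpos : ∀ x, 0 ≤ (inner ℂ x (A x)).re) :
    HilbertSchmidtBound (compression A v - modulusDiagonal A v) (4 * C) := by
  have hv := h.orthonormal
  refine hilbertSchmidtBound_of_orthonormal hv (fun x => ?_) (fun x => ?_) ?_
  · rw [sub_apply, map_sub, h.diagonalOperator_one_compression, modulusDiagonal,
      diagonalOperator_diagonalOperator hv, one_mul]
  · rw [sub_apply, sub_apply, h.compression_diagonalOperator_one,
      modulusDiagonal, diagonalOperator_diagonalOperator hv, mul_one]
  refine le_trans ?_ (mul_le_mul_of_nonneg_left (hB _ _ v v hv hv) (by simp))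
  rw [Finset.mul_sum]
  refine Finset.sum_le_sum fun i _ => ?_
  rw [Finset.mul_sum]
  refine Finset.sum_le_sum fun j _ => ?_
  have hentry : inner ℂ (v i) ((compression A v - modulusDiagonal A v) (v j)) =
      inner ℂ (v i) (A (v j)) -
        ‖inner ℂ (v i) (A (v i))‖ * (if i = j then 1 else 0 : ℂ) := by
    rw [sub_apply, inner_sub_right, h.inner_compression, modulusDiagonal,
      inner_diagonalOperator hv]
    simp [orthonormal_iff_ite.1 hv]
  have hle : ‖inner ℂ (v i) ((compression A v - modulusDiagonal A v) (v j))‖ ≤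
      2 * ‖inner ℂ (v i) (B (v j))‖ := by
    rw [hentry]
    rcases lt_trichotomy i j with hij | rfl | hij
    · simp [hij.ne, h.norm_entry_le hAB hij]
    · simp only [if_true, mul_one]
      refine (norm_sub_norm_le_two_mul_abs_im (hpos _)).trans ?_
      have h1 := hAB (v i) (v i)
      rw [← inner_conj_symm (A (v i)), Complex.sub_conj] at h1
      have h2 := congrArg norm h1
      simp only [norm_mul, Complex.norm_I, Complex.norm_real, Real.norm_eq_abs, mul_one] at h2
      simp at h2
      linarith
    · simp [hij.ne', h.triangular i j hij]
  calc _ ≤ (2 * ‖inner ℂ (v i) (B (v j))‖) ^ 2 := pow_le_pow_left₀ (norm_nonneg _) hle 2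
    _ = _ := by ring

theorem norm_modulusDiagonal_sub_smul_le (h : IsSchurFrame A v) {a b s d : ℝ} (ha : s - d ≤ a)
    (hb : b ≤ s + d) (hd : 0 ≤ d) (hab : a ≤ b) (y : E) :
    ‖modulusDiagonal A v (cutoff A v b y - cutoff A v a y) -
      (s : ℂ) • (cutoff A v b y - cutoff A v a y)‖ ≤ d * ‖y‖ := by
  have hv := h.orthonormal
  rw [cutoff, cutoff, diagonalOperator_sub_apply, modulusDiagonal,
    diagonalOperator_diagonalOperator hv]
  have hs (c : Fin N → ℂ) : (s : ℂ) • diagonalOperator v c y =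
      diagonalOperator v ((s : ℂ) • c) y := by
    simp [diagonalOperator_apply, Finset.smul_sum, smul_smul, mul_assoc]
  rw [hs, diagonalOperator_sub_apply]
  refine norm_diagonalOperator_le_norm hv hd (fun i => ?_) y
  simp only [Pi.sub_apply, Pi.mul_apply, Pi.smul_apply, smul_eq_mul]
  rcases cutoffSymbol_eq A v a i with hi | hi <;> rcases cutoffSymbol_eq A v b i with hj | hj
  · simp [hi.1, hj.1, hd]
  · linarith [hi.2, hj.2]
  · rw [hi.1, hj.1, sub_zero, mul_one, mul_one, ← Complex.ofReal_sub, Complex.norm_real,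
      Real.norm_eq_abs, abs_le]
    exact ⟨by linarith [hi.2], by linarith [hj.2]⟩
  · simp [hi.1, hj.1, hd]

theorem cutoff_of_norm_le (h : IsSchurFrame A v) {c : ℝ} (hc : ‖A‖ ≤ c) (y : E) :
    cutoff A v c y = diagonalOperator v 1 y := by
  have : cutoffSymbol A v c = 1 := by
    funext i
    rcases cutoffSymbol_eq A v c i with hi | hi
    · exact hi.1
    · have h1 := norm_inner_le_norm (𝕜 := ℂ) (v i) (A (v i))
      have h2 := A.le_opNorm (v i)
      rw [h.orthonormal.1] at h1 h2
      linarith [hi.2]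
  rw [cutoff, this]

theorem inner_cutoff_self (h : IsSchurFrame A v) (c : ℝ) (x : E) :
    inner ℂ x (cutoff A v c x) = ‖cutoff A v c x‖ ^ 2 := by
  have h1 : star (cutoffSymbol A v c) * cutoffSymbol A v c = cutoffSymbol A v c := by
    funext i
    rcases cutoffSymbol_eq A v c i with hi | hi <;> simp [hi.1]
  have h2 := inner_self_eq_norm_sq_to_K (𝕜 := ℂ) (cutoff A v c x)
  rw [cutoff, inner_diagonalOperator_left, diagonalOperator_diagonalOperator h.orthonormal, h1] at h2
  exact h2

theorem norm_cutoff_le (h : IsSchurFrame A v) (c : ℝ) (x : E) : ‖cutoff A v c x‖ ≤ ‖x‖ := by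
  rw [← one_mul ‖x‖]
  refine norm_diagonalOperator_le_norm h.orthonormal zero_le_one (fun i => ?_) x
  rcases cutoffSymbol_eq A v c i with hi | hi <;> simp [hi.1]

theorem norm_sub_cutoff_le_norm (h : IsSchurFrame A v) (c : ℝ) (x : E) :
    ‖diagonalOperator v 1 x - cutoff A v c x‖ ≤ ‖x‖ := by
  rw [sub_cutoff_apply, ← one_mul ‖x‖]
  refine norm_diagonalOperator_le_norm h.orthonormal zero_le_one (fun i => ?_) x
  rcases cutoffSymbol_eq A v c i with hi | hi <;> simp [hi.1]

theorem norm_sub_cutoff_compression_le (h : IsSchurFrame A v) (c : ℝ) (x : E) :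
    ‖diagonalOperator v 1 (compression A v x) - cutoff A v c (compression A v x)‖ ≤
      ‖A‖ * ‖diagonalOperator v 1 x - cutoff A v c x‖ := by
  have hv := h.orthonormal
  have hP (x : E) : ‖diagonalOperator v 1 x‖ ≤ ‖x‖ := by
    rw [← one_mul ‖x‖]
    exact norm_diagonalOperator_le_norm hv zero_le_one (by simp) x
  rw [sub_cutoff_apply, h.diagonalOperator_one_sub_compression, ← sub_cutoff_apply,
    ← sub_cutoff_apply]
  refine (h.norm_sub_cutoff_le_norm c _).trans ((hP _).trans ((A.le_opNorm _).trans ?_))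
  exact mul_le_mul_of_nonneg_left (hP _) (norm_nonneg _)

end IsSchurFrame

end FrameEstimates

section UltrafilterLimit

open Filter Topology

variable {E : Type*} [NormedAddCommGroup E] [InnerProductSpace ℂ E] {ι : Type*}

theorem exists_weak_limit [CompleteSpace E] (U : Ultrafilter ι) {x : ι → E} {r : ℝ}
    (hx : ∀ a, ‖x a‖ ≤ r) :
    ∃ y, ∀ u, Tendsto (fun a => inner ℂ u (x a)) U (𝓝 (inner ℂ u y)) := by
  let φ : ι → WeakDual ℂ E := fun a =>
    StrongDual.toWeakDual (InnerProductSpace.toDual ℂ E (x a))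
  obtain ⟨f, -, hf⟩ := (WeakDual.isCompact_closedBall (𝕜 := ℂ) (E := E) 0 r).ultrafilter_le_nhds
    (U.map φ) (by
      rw [le_principal_iff, Ultrafilter.coe_map, mem_map]
      refine Filter.Eventually.of_forall fun a => ?_
      simpa [φ] using hx a)
  refine ⟨(InnerProductSpace.toDual ℂ E).symm (WeakDual.toStrongDual f), fun u => ?_⟩
  have h1 : Tendsto (fun a => inner ℂ (x a) u) U (𝓝 (f u)) :=
    ((WeakDual.eval_continuous u).tendsto f).comp (show Tendsto φ U (𝓝 f) from hf)
  have h2 : inner ℂ ((InnerProductSpace.toDual ℂ E).symm (WeakDual.toStrongDual f)) u = f u :=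
    InnerProductSpace.toDual_symm_apply
  rw [← inner_conj_symm, h2]
  simpa only [inner_conj_symm, Function.comp_def] using (Complex.continuous_conj.tendsto _).comp h1

variable {A : E →L[ℂ] E} {U : Ultrafilter ι} {N : ι → ℕ} {v : ∀ a, Fin (N a) → E}

theorem eventually_compression_pow_apply
    (hP : ∀ x, ∀ᶠ a in U, diagonalOperator (v a) 1 x = x) (k : ℕ) (x : E) :
    ∀ᶠ a in U, (compression A (v a) ^ k) x = (A ^ k) x := by
  induction k with
  | zero => simp
  | succ k ih =>
    filter_upwards [ih, hP ((A ^ k) x), hP ((A ^ (k + 1)) x)] with a h1 h2 h3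
    rw [pow_succ', mul_apply_eq_comp, h1, compression, ContinuousLinearMap.comp_apply,
      ContinuousLinearMap.comp_apply, h2]
    rwa [pow_succ', mul_apply_eq_comp] at h3 ⊢

theorem eventually_inner_compression_pow [CompleteSpace E]
    (hP : ∀ x, ∀ᶠ a in U, diagonalOperator (v a) 1 x = x) (k : ℕ) (u : E) :
    ∀ᶠ a in U, ∀ z, inner ℂ u ((compression A (v a) ^ k) z) =
      inner ℂ ((ContinuousLinearMap.adjoint (A ^ k)) u) z := by
  induction k generalizing u with
  | zero => simp [ContinuousLinearMap.adjoint_inner_left]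
  | succ k ih =>
    filter_upwards [ih ((ContinuousLinearMap.adjoint A) u), hP u,
      hP ((ContinuousLinearMap.adjoint A) u)] with a h1 h2 h3 z
    have hswap (x y : E) : inner ℂ x (diagonalOperator (v a) 1 y) =
        inner ℂ (diagonalOperator (v a) 1 x) y := by
      rw [inner_diagonalOperator_left, star_one]
    rw [pow_succ', mul_apply_eq_comp, compression, ContinuousLinearMap.comp_apply,
      ContinuousLinearMap.comp_apply, hswap, h2, ← ContinuousLinearMap.adjoint_inner_left, hswap,
      h3, ← compression, h1, pow_succ', ContinuousLinearMap.adjoint_inner_left,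
      ContinuousLinearMap.adjoint_inner_left, ContinuousLinearMap.adjoint_inner_left,
      mul_apply_eq_comp]

variable (A U v) in
/-- The vectors that are asymptotically contained in the ranges of the cutoffs at `c`. -/
def limitSubspace (c : ℝ) : Submodule ℂ E where
  carrier := {y | Tendsto (fun a => diagonalOperator (v a) 1 y - cutoff A (v a) c y) U (𝓝 0)}
  zero_mem' := by simp
  add_mem' {x y} hx hy := by
    simpa [add_sub_add_comm] using Tendsto.add hx hy
  smul_mem' r x hx := by
    simpa [smul_sub] using Tendsto.const_smul hx r

theorem mem_limitSubspace {c : ℝ} {y : E} : y ∈ limitSubspace A U v c ↔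
    Tendsto (fun a => diagonalOperator (v a) 1 y - cutoff A (v a) c y) U (𝓝 0) := Iff.rfl

theorem isClosed_limitSubspace (h : ∀ a, IsSchurFrame A (v a)) (c : ℝ) :
    IsClosed (limitSubspace A U v c : Set E) := by
  refine isClosed_of_closure_subset fun y hy => ?_
  change Tendsto _ _ _
  rw [Metric.tendsto_nhds]
  intro e he
  obtain ⟨z, hz, hyz⟩ := Metric.mem_closure_iff.1 hy (e / 2) (half_pos he)
  filter_upwards [Metric.tendsto_nhds.1 (mem_limitSubspace.1 hz) (e / 2) (half_pos he)] with a ha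
  rw [dist_zero_right] at ha ⊢
  rw [dist_eq_norm] at hyz
  have h1 := (h a).norm_sub_cutoff_le_norm c (y - z)
  have h2 : diagonalOperator (v a) 1 y - cutoff A (v a) c y =
      (diagonalOperator (v a) 1 (y - z) - cutoff A (v a) c (y - z)) +
        (diagonalOperator (v a) 1 z - cutoff A (v a) c z) := by
    simp only [map_sub]
    abel
  rw [h2]
  refine (norm_add_le _ _).trans_lt ?_
  linarith

theorem apply_mem_limitSubspace (h : ∀ a, IsSchurFrame A (v a))
    (hP : ∀ x, ∀ᶠ a in U, diagonalOperator (v a) 1 x = x) {c : ℝ} {y : E}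
    (hy : y ∈ limitSubspace A U v c) : A y ∈ limitSubspace A U v c := by
  rw [mem_limitSubspace, tendsto_zero_iff_norm_tendsto_zero] at hy ⊢
  have hy' := hy.const_mul ‖A‖
  rw [mul_zero] at hy'
  refine squeeze_zero' (Eventually.of_forall fun _ => norm_nonneg _) ?_ hy'
  filter_upwards [eventually_compression_pow_apply (A := A) hP 1 y] with a ha
  rw [pow_one, pow_one] at ha
  rw [← ha]
  exact (h a).norm_sub_cutoff_compression_le c y

theorem limitSubspace_eq_bot_of_neg (hP : ∀ x, ∀ᶠ a in U, diagonalOperator (v a) 1 x = x)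
    {c : ℝ} (hc : c < 0) : limitSubspace A U v c = ⊥ := by
  rw [eq_bot_iff]
  intro y hy
  rw [mem_limitSubspace] at hy
  simp only [cutoff_of_neg A _ hc, sub_zero] at hy
  exact tendsto_nhds_unique (tendsto_const_nhds.congr' ((hP y).mono fun a ha => ha.symm)) hy

theorem limitSubspace_eq_top_of_norm_le (h : ∀ a, IsSchurFrame A (v a)) {c : ℝ} (hc : ‖A‖ ≤ c) :
    limitSubspace A U v c = ⊤ := by
  rw [eq_top_iff]
  intro y _
  rw [mem_limitSubspace]
  simp [(h _).cutoff_of_norm_le hc]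

theorem limitSubspace_ne_bot [CompleteSpace E] (h : ∀ a, IsSchurFrame A (v a))
    (hP : ∀ x, ∀ᶠ a in U, diagonalOperator (v a) 1 x = x) {C : ℝ}
    (hC : ∀ a, ∑ i, ∑ j ∈ Finset.Ioi i, ‖inner ℂ (v a i) (A (v a j))‖ ^ 2 ≤ C)
    {c c' : ℝ} (hc : 0 ≤ c) (hcc : c < c') {x : E}
    (hx : ¬Tendsto (fun a => cutoff A (v a) c x) U (𝓝 0)) : limitSubspace A U v c' ≠ ⊥ := by
  obtain ⟨y, hy⟩ := exists_weak_limit U fun a => (h a).norm_cutoff_le c x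
  have hy0 : y ≠ 0 := by
    rintro rfl
    refine hx ?_
    have h1 := hy x
    simp only [(h _).inner_cutoff_self, inner_zero_right] at h1
    rw [tendsto_zero_iff_norm_tendsto_zero] at h1 ⊢
    simp only [norm_pow, Complex.norm_real, norm_norm] at h1
    simpa using h1.sqrt
  obtain ⟨e, he, hed⟩ : ∃ e, 0 < e ∧ c' - c = 4 * e := ⟨(c' - c) / 4, by linarith, by ring⟩
  set K := Real.exp (C / e ^ 2)
  have hK : 0 < K := Real.exp_pos _
  have hpow (k : ℕ) : ‖(A ^ k) y‖ ≤ K * (c + e) ^ k * ‖x‖ := by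
    have h1 (u : E) : ‖inner ℂ u ((A ^ k) y)‖ ≤ ‖u‖ * (K * (c + e) ^ k * ‖x‖) := by
      have h2 := (hy ((ContinuousLinearMap.adjoint (A ^ k)) u)).norm
      rw [ContinuousLinearMap.adjoint_inner_left] at h2
      refine le_of_tendsto h2 ?_
      filter_upwards [eventually_inner_compression_pow hP k u] with a ha
      rw [← ha]
      exact (norm_inner_le_norm _ _).trans (mul_le_mul_of_nonneg_left
        ((h a).norm_compression_pow_cutoff_le he (hC a) hc k x) (norm_nonneg _))
    have h3 := h1 ((A ^ k) y)
    rw [inner_self_eq_norm_sq_to_K, norm_pow] at h3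
    by_cases h0 : ‖(A ^ k) y‖ = 0
    · rw [h0]
      positivity
    · have h4 : 0 < ‖(A ^ k) y‖ := lt_of_le_of_ne (norm_nonneg _) (Ne.symm h0)
      refine le_of_mul_le_mul_left (le_trans (le_of_eq ?_) h3) h4
      simp [sq]
  have hmem : y ∈ limitSubspace A U v c' := by
    rw [mem_limitSubspace, Metric.tendsto_nhds]
    intro δ hδ
    have hq0 : 0 < c' - e := by linarith
    have hq : Tendsto (fun k : ℕ => K * (K * ‖x‖) * ((c + e) / (c' - e)) ^ k) atTop (𝓝 0) := by
      have := (tendsto_pow_atTop_nhds_zero_of_lt_one (r := (c + e) / (c' - e)) (by positivity)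
        ((div_lt_one hq0).2 (by linarith))).const_mul (K * (K * ‖x‖))
      rwa [mul_zero] at this
    obtain ⟨k, hk⟩ := (hq.eventually (gt_mem_nhds hδ)).exists
    filter_upwards [eventually_compression_pow_apply (A := A) hP k y] with a ha
    rw [dist_zero_right]
    refine lt_of_le_of_lt ?_ hk
    have h1 := (h a).norm_sub_cutoff_le he (hC a) (c := c') (by linarith) k y
    rw [ha] at h1
    have h2 := h1.trans (mul_le_mul_of_nonneg_left (hpow k) hK.le)
    rw [div_pow, ← mul_div_assoc, le_div_iff₀ (pow_pos hq0 k)]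
    linarith
  intro hbot
  rw [hbot] at hmem
  exact hy0 hmem

theorem HilbertSchmidtBound.of_tendsto {S : ι → E →L[ℂ] E} {T : E →L[ℂ] E} {C : ℝ}
    (hS : ∀ a, HilbertSchmidtBound (S a) C)
    (hT : ∀ x, Tendsto (fun a => S a x) U (𝓝 (T x))) : HilbertSchmidtBound T C := by
  intro m n f g hf hg
  refine le_of_tendsto (x := (U : Filter ι)) (tendsto_finsetSum _ fun i _ =>
    tendsto_finsetSum _ fun j _ => ((tendsto_const_nhds.inner (hT (g j))).norm.pow 2))
    (Eventually.of_forall fun a => hS a m n f g hf hg)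

theorem tendsto_modulusDiagonal (h : ∀ a, IsSchurFrame A (v a))
    (hP : ∀ x, ∀ᶠ a in U, diagonalOperator (v a) 1 x = x) {s : ℝ}
    (hlt : ∀ c < s, ∀ x, Tendsto (fun a => cutoff A (v a) c x) U (𝓝 0))
    (hgt : ∀ c > s, limitSubspace A U v c = ⊤) (x : E) :
    Tendsto (fun a => modulusDiagonal A (v a) x) U (𝓝 ((s : ℂ) • x)) := by
  rw [Metric.tendsto_nhds]
  intro e he
  obtain ⟨d, hd, hde⟩ : ∃ d, 0 < d ∧ d * ‖x‖ < e / 2 := by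
    refine ⟨e / 2 / (‖x‖ + 1), by positivity, ?_⟩
    rw [div_mul_eq_mul_div, div_lt_iff₀ (by positivity)]
    nlinarith [norm_nonneg x]
  have h1 : Tendsto (fun a => x - (cutoff A (v a) (s + d) x - cutoff A (v a) (s - d) x)) U
      (𝓝 0) := by
    have h2 : x ∈ limitSubspace A U v (s + d) := by
      rw [hgt _ (by linarith)]
      trivial
    have h3 := (mem_limitSubspace.1 h2).add (hlt (s - d) (by linarith) x)
    rw [add_zero] at h3
    refine h3.congr' ?_
    filter_upwards [hP x] with a ha
    rw [ha]
    abel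
  have h4 := (h1.norm.const_mul (‖A‖ + |s|))
  rw [norm_zero, mul_zero] at h4
  filter_upwards [h4.eventually (gt_mem_nhds (half_pos he))] with a ha
  set w := cutoff A (v a) (s + d) x - cutoff A (v a) (s - d) x
  have h5 : ‖modulusDiagonal A (v a) w - (s : ℂ) • w‖ ≤ d * ‖x‖ :=
    (h a).norm_modulusDiagonal_sub_smul_le le_rfl le_rfl hd.le (by linarith) x
  have h6 : ‖modulusDiagonal A (v a) (x - w)‖ ≤ ‖A‖ * ‖x - w‖ := by
    refine norm_diagonalOperator_le_norm (h a).orthonormal (norm_nonneg _) (fun i => ?_) _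
    have h7 := norm_inner_le_norm (𝕜 := ℂ) (v a i) (A (v a i))
    have h8 := A.le_opNorm (v a i)
    rw [(h a).orthonormal.1] at h7 h8
    rw [Complex.norm_real, norm_norm]
    linarith
  have h9 : modulusDiagonal A (v a) x - (s : ℂ) • x = modulusDiagonal A (v a) (x - w) +
      (modulusDiagonal A (v a) w - (s : ℂ) • w) - (s : ℂ) • (x - w) := by
    simp only [map_sub, smul_sub]
    abel
  rw [dist_eq_norm, h9]
  have h10 : ‖(s : ℂ) • (x - w)‖ = |s| * ‖x - w‖ := by
    rw [norm_smul, Complex.norm_real, Real.norm_eq_abs]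
  have h11 := norm_sub_le (modulusDiagonal A (v a) (x - w) +
      (modulusDiagonal A (v a) w - (s : ℂ) • w)) ((s : ℂ) • (x - w))
  have h12 := norm_add_le (modulusDiagonal A (v a) (x - w))
    (modulusDiagonal A (v a) w - (s : ℂ) • w)
  linarith

variable (A) in
theorem exists_ultrafilter_schurFrame :
    ∃ (U : Ultrafilter (Finset E)) (N : Finset E → ℕ) (v : ∀ a, Fin (N a) → E),
      (∀ a, IsSchurFrame A (v a)) ∧ ∀ x, ∀ᶠ a in U, diagonalOperator (v a) 1 x = x := by
  classical
  have key (a : Finset E) : ∃ v : Fin (Module.finrank ℂ (Submodule.span ℂ (a : Set E))) → E,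
      IsSchurFrame A v ∧ Submodule.span ℂ (Set.range v) = Submodule.span ℂ (a : Set E) := by
    obtain ⟨v, h1, h2, h3, h4⟩ := exists_ordered_schur_basis A _ (Submodule.span ℂ (a : Set E)) rfl
    exact ⟨v, ⟨h1, h3, h4⟩, h2⟩
  choose v hv hspan using key
  refine ⟨Ultrafilter.of atTop, _, v, hv, fun x => Ultrafilter.of_le _ ?_⟩
  filter_upwards [eventually_ge_atTop {x}] with a ha
  rw [diagonalOperator_one_eq_starProjection (hv a).orthonormal _ (hspan a),
    Submodule.starProjection_eq_self_iff]
  exact Submodule.subset_span (ha (Finset.mem_singleton_self x))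

/-- An operator with positive real part and Hilbert–Schmidt imaginary part that has no nontrivial
closed invariant subspace is a Hilbert–Schmidt perturbation of a scalar. -/
theorem exists_hilbertSchmidtBound_sub_smul [CompleteSpace E] [Nontrivial E] {A B : E →L[ℂ] E}
    {C : ℝ} (hB : HilbertSchmidtBound B C)
    (hAB : ∀ x y, inner ℂ x (A y) - inner ℂ (A x) y = 2 * Complex.I * inner ℂ x (B y))
    (hpos : ∀ x, 0 ≤ (inner ℂ x (A x)).re)
    (hirr : ∀ M : Submodule ℂ E, IsClosed (M : Set E) → (∀ x ∈ M, A x ∈ M) → M = ⊥ ∨ M = ⊤) :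
    ∃ s : ℂ, HilbertSchmidtBound (A - s • 1) (4 * C) := by
  obtain ⟨U, N, v, h, hP⟩ := exists_ultrafilter_schurFrame A
  have hC (a) := (h a).sum_norm_sq_offDiagonal_le hB hAB
  have hdich (c : ℝ) : limitSubspace A U v c = ⊥ ∨ limitSubspace A U v c = ⊤ :=
    hirr _ (isClosed_limitSubspace h c) fun x hx => apply_mem_limitSubspace h hP hx
  let S : Set ℝ := {c | limitSubspace A U v c = ⊥}
  have hSne : S.Nonempty := ⟨-1, limitSubspace_eq_bot_of_neg hP (by norm_num)⟩
  have hS : BddAbove S := by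
    refine ⟨‖A‖, fun c hc => ?_⟩
    by_contra! hlt
    exact bot_ne_top ((show _ = ⊥ from hc).symm.trans (limitSubspace_eq_top_of_norm_le h hlt.le))
  have hgt (c : ℝ) (hc : c > sSup S) : limitSubspace A U v c = ⊤ :=
    (hdich c).resolve_left fun hbot => (le_csSup hS hbot).not_gt hc
  have hlt (c : ℝ) (hc : c < sSup S) (x : E) :
      Tendsto (fun a => cutoff A (v a) c x) U (𝓝 0) := by
    rcases lt_or_ge c 0 with h0 | h0
    · simp [cutoff_of_neg A _ h0]
    · obtain ⟨c', hc', hcc⟩ := exists_lt_of_lt_csSup hSne hc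
      by_contra hx
      exact limitSubspace_ne_bot h hP hC h0 hcc hx hc'
  refine ⟨(sSup S : ℝ), HilbertSchmidtBound.of_tendsto (U := U)
    (fun a => (h a).hilbertSchmidtBound_compression_sub hB hAB hpos) fun x => ?_⟩
  have h1 : Tendsto (fun a => compression A (v a) x) U (𝓝 (A x)) := by
    refine tendsto_const_nhds.congr' ?_
    filter_upwards [eventually_compression_pow_apply (A := A) hP 1 x] with a ha
    simpa using ha.symm
  simpa using h1.sub (tendsto_modulusDiagonal h hP hlt hgt x)

end UltrafilterLimit

section CompactOperator

open Filter Topology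

theorem tendsto_pow_mul_norm_pow_of_spectrum_subset_zero {R : Type*} [NormedRing R]
    [NormedAlgebra ℂ R] [CompleteSpace R] {a : R} (ha : spectrum ℂ a ⊆ {0}) (M : ℝ) :
    Tendsto (fun n : ℕ => M ^ n * ‖a ^ n‖) atTop (𝓝 0) := by
  have hrad : spectralRadius ℂ a = 0 := by
    refine le_antisymm (iSup₂_le fun z hz => ?_) zero_le
    rw [Set.mem_singleton_iff.1 (ha hz)]
    simp
  have hlim := spectrum.pow_norm_pow_one_div_tendsto_nhds_spectralRadius a
  rw [hrad] at hlim
  have he : (0 : ℝ) < 1 / (2 * (|M| + 1)) := by positivity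
  refine squeeze_zero_norm' ?_
    (tendsto_pow_atTop_nhds_zero_of_lt_one (r := (1 / 2 : ℝ)) (by norm_num) (by norm_num))
  filter_upwards [hlim.eventually (gt_mem_nhds (ENNReal.ofReal_pos.2 he)),
    eventually_gt_atTop 0] with n hn hn0
  rw [ENNReal.ofReal_lt_ofReal_iff he] at hn
  have h1 : ‖a ^ n‖ ≤ (1 / (2 * (|M| + 1))) ^ n := by
    calc ‖a ^ n‖ = (‖a ^ n‖ ^ (1 / n : ℝ)) ^ n := by
          rw [one_div, Real.rpow_inv_natCast_pow (norm_nonneg _) hn0.ne']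
      _ ≤ _ := pow_le_pow_left₀ (by positivity) hn.le n
  rw [norm_mul, norm_pow, Real.norm_eq_abs, norm_norm]
  calc |M| ^ n * ‖a ^ n‖ ≤ (|M| + 1) ^ n * (1 / (2 * (|M| + 1))) ^ n := by
        gcongr
        linarith
    _ = (1 / 2) ^ n := by
        rw [← mul_pow]
        congr 1
        field_simp

variable {E : Type*} [NormedAddCommGroup E] [NormedSpace ℂ E]

theorem dense_commutant_orbit {K : E →L[ℂ] E}
    (hirr : ∀ M : Submodule ℂ E, IsClosed (M : Set E) → (∀ x ∈ M, K x ∈ M) → M = ⊥ ∨ M = ⊤)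
    {y : E} (hy : y ≠ 0) : Dense {z | ∃ T : E →L[ℂ] E, Commute K T ∧ T y = z} := by
  let M : Submodule ℂ E :=
    { carrier := {z | ∃ T : E →L[ℂ] E, Commute K T ∧ T y = z}
      zero_mem' := ⟨0, Commute.zero_right K, rfl⟩
      add_mem' := by
        rintro _ _ ⟨S, hS, rfl⟩ ⟨T, hT, rfl⟩
        exact ⟨S + T, hS.add_right hT, rfl⟩
      smul_mem' := by
        rintro r _ ⟨T, hT, rfl⟩
        exact ⟨r • T, hT.smul_right r, rfl⟩ }
  have hinv (x : E) (hx : x ∈ M.topologicalClosure) : K x ∈ M.topologicalClosure := by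
    refine map_mem_closure K.continuous hx ?_
    rintro _ ⟨T, hT, rfl⟩
    exact ⟨K * T, (Commute.refl K).mul_right hT, rfl⟩
  rcases hirr _ M.isClosed_topologicalClosure hinv with hM | hM
  · have hyM : y ∈ M.topologicalClosure :=
      M.le_topologicalClosure ⟨1, Commute.one_right K, rfl⟩
    rw [hM] at hyM
    exact absurd hyM hy
  · exact M.dense_iff_topologicalClosure_eq_top.2 hM

/-- Hilden's form of Lomonosov's argument for quasinilpotent compact operators. -/
theorem IsCompactOperator.exists_invariant_of_spectrum_subset_zero [CompleteSpace E]
    {K : E →L[ℂ] E} (hK : IsCompactOperator K) (hspec : spectrum ℂ K ⊆ {0}) {x₀ : E}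
    (hx₀ : K x₀ ≠ 0) :
    ∃ M : Submodule ℂ E, IsClosed (M : Set E) ∧ (∀ x ∈ M, K x ∈ M) ∧ M ≠ ⊥ ∧ M ≠ ⊤ := by
  by_contra! hcon
  have hirr (M : Submodule ℂ E) (hM : IsClosed (M : Set E)) (hinv : ∀ x ∈ M, K x ∈ M) :
      M = ⊥ ∨ M = ⊤ := or_iff_not_imp_left.2 (hcon M hM hinv)
  have hKx : 0 < ‖K x₀‖ := norm_pos_iff.2 hx₀
  have hle := K.le_opNorm x₀
  have hKpos : 0 < ‖K‖ := by
    by_contra! h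
    nlinarith [norm_nonneg x₀]
  obtain ⟨r, hr1, hr2⟩ : ∃ r, ‖K‖ * r = ‖K x₀‖ / 2 ∧ r < ‖x₀‖ := by
    refine ⟨‖K x₀‖ / 2 / ‖K‖, by field_simp, ?_⟩
    rw [div_lt_iff₀ hKpos]
    linarith
  have hr0 : 0 < r := by
    by_contra! h
    nlinarith
  set Z := closure (K '' Metric.closedBall x₀ r)
  have hZc : IsCompact Z :=
    IsCompactOperator.isCompact_closure_image_of_bounded (f := (K : E →ₗ[ℂ] E)) hK
      Metric.isBounded_closedBall
  have hZ0 (y : E) (hy : y ∈ Z) : y ≠ 0 := by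
    have hsub : Z ⊆ {y | ‖K x₀‖ / 2 ≤ ‖y‖} := by
      refine closure_minimal ?_ (isClosed_le continuous_const continuous_norm)
      rintro _ ⟨x, hx, rfl⟩
      rw [Metric.mem_closedBall, dist_eq_norm] at hx
      have h1 := K.le_opNorm (x - x₀)
      have h2 : ‖K‖ * ‖x - x₀‖ ≤ ‖K‖ * r := mul_le_mul_of_nonneg_left hx hKpos.le
      have h3 : ‖K x₀‖ ≤ ‖K x‖ + ‖K (x - x₀)‖ := by
        have := norm_sub_le (K x) (K (x - x₀))
        rwa [← map_sub, sub_sub_cancel] at this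
      change ‖K x₀‖ / 2 ≤ ‖K x‖
      linarith
    have h4 : ‖K x₀‖ / 2 ≤ ‖y‖ := hsub hy
    exact norm_pos_iff.1 (by linarith)
  obtain ⟨t, ht⟩ := hZc.elim_finite_subcover
    (fun T : {T : E →L[ℂ] E // Commute K T} => T.1 ⁻¹' Metric.ball x₀ r)
    (fun T => Metric.isOpen_ball.preimage T.1.continuous) (fun y hy => by
      obtain ⟨_, hmem, T, hT, rfl⟩ := (dense_commutant_orbit hirr (hZ0 y hy)).inter_open_nonempty
        (Metric.ball x₀ r) Metric.isOpen_ball ⟨x₀, Metric.mem_ball_self hr0⟩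
      exact Set.mem_iUnion.2 ⟨⟨T, hT⟩, hmem⟩)
  set M := ∑ T ∈ t, ‖T.1‖
  have hM0 : 0 ≤ M := Finset.sum_nonneg fun _ _ => norm_nonneg _
  have hiter (n : ℕ) : ∃ T : E →L[ℂ] E, Commute K T ∧ ‖T‖ ≤ M ^ n ∧
      T ((K ^ n) x₀) ∈ Metric.closedBall x₀ r := by
    induction n with
    | zero =>
      refine ⟨1, Commute.one_right K, ?_, ?_⟩
      · rw [pow_zero]
        exact ContinuousLinearMap.norm_id_le
      · simpa using hr0.le
    | succ n ih =>
      obtain ⟨T, hT, hTM, hTx⟩ := ih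
      obtain ⟨S, hS, hSx⟩ := Set.mem_iUnion₂.1 (ht (subset_closure ⟨_, hTx, rfl⟩))
      refine ⟨S.1 * T, S.2.mul_right hT, ?_, ?_⟩
      · rw [pow_succ']
        exact (norm_mul_le _ _).trans (mul_le_mul
          (Finset.single_le_sum (f := fun T => ‖T.1‖) (fun _ _ => norm_nonneg _) hS) hTM
          (norm_nonneg _) hM0)
      · have : (S.1 * T) ((K ^ (n + 1)) x₀) = S.1 (K (T ((K ^ n) x₀))) := by
          rw [pow_succ', mul_apply_eq_comp, mul_apply_eq_comp]
          exact congrArg S.1 (DFunLike.congr_fun hT.eq ((K ^ n) x₀)).symm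
        rw [this]
        exact Metric.ball_subset_closedBall hSx
  have hlim := (tendsto_pow_mul_norm_pow_of_spectrum_subset_zero hspec M).mul_const ‖x₀‖
  rw [zero_mul] at hlim
  obtain ⟨n, hn⟩ := (hlim.eventually (gt_mem_nhds (sub_pos.2 hr2))).exists
  obtain ⟨T, -, hTM, hTx⟩ := hiter n
  rw [Metric.mem_closedBall, dist_eq_norm] at hTx
  have h1 : ‖T ((K ^ n) x₀)‖ ≤ M ^ n * ‖K ^ n‖ * ‖x₀‖ := by
    rw [mul_assoc]
    exact (T.le_opNorm _).trans (mul_le_mul hTM ((K ^ n).le_opNorm _) (norm_nonneg _)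
      (pow_nonneg hM0 n))
  have h2 := norm_sub_norm_le x₀ (T ((K ^ n) x₀))
  rw [norm_sub_rev] at h2
  linarith

theorem exists_invariant_of_eigenvector (hE : 1 < Module.rank ℂ E) {K : E →L[ℂ] E} {μ : ℂ}
    {x : E} (hx : x ≠ 0) (hKx : K x = μ • x) :
    ∃ M : Submodule ℂ E, IsClosed (M : Set E) ∧ (∀ x ∈ M, K x ∈ M) ∧ M ≠ ⊥ ∧ M ≠ ⊤ := by
  refine ⟨ℂ ∙ x, Submodule.closed_of_finiteDimensional _, fun y hy => ?_, ?_, fun htop => ?_⟩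
  · obtain ⟨c, rfl⟩ := Submodule.mem_span_singleton.1 hy
    rw [map_smul, hKx]
    exact Submodule.smul_mem _ _ (Submodule.smul_mem _ _ (Submodule.mem_span_singleton_self x))
  · rwa [Ne, Submodule.span_singleton_eq_bot]
  · refine hE.not_ge (rank_le_one_iff.2 ⟨x, fun y => Submodule.mem_span_singleton.1 ?_⟩)
    rw [htop]
    trivial

/-- Compact operators have nontrivial closed invariant subspaces. -/
theorem IsCompactOperator.exists_invariant [CompleteSpace E] (hE : 1 < Module.rank ℂ E)
    {K : E →L[ℂ] E} (hK : IsCompactOperator K) :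
    ∃ M : Submodule ℂ E, IsClosed (M : Set E) ∧ (∀ x ∈ M, K x ∈ M) ∧ M ≠ ⊥ ∧ M ≠ ⊤ := by
  have : Nontrivial E := rank_pos_iff_nontrivial.1 (zero_lt_one.trans hE)
  by_cases heig : ∃ (μ : ℂ) (x : E), x ≠ 0 ∧ K x = μ • x
  · obtain ⟨μ, x, hx, hKx⟩ := heig
    exact exists_invariant_of_eigenvector hE hx hKx
  push Not at heig
  obtain ⟨x₀, hx₀⟩ := exists_ne (0 : E)
  refine hK.exists_invariant_of_spectrum_subset_zero (x₀ := x₀) (fun μ hμ => ?_) ?_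
  · by_contra hμ0
    rcases hK.hasEigenvalue_or_mem_resolventSet hμ0 with h | h
    · obtain ⟨x, hx⟩ := h.exists_hasEigenvector
      exact heig μ x hx.2 hx.apply_eq_smul
    · exact hμ h
  · simpa using heig 0 x₀ hx₀

end CompactOperator

section InvariantSubspace

variable {E : Type*} [NormedAddCommGroup E] [InnerProductSpace ℂ E] [CompleteSpace E]

/-- An operator with Hilbert–Schmidt imaginary part `B` has a nontrivial closed invariant
subspace. -/
theorem HilbertSchmidtBound.exists_invariant (hE : 1 < Module.rank ℂ E) {A B : E →L[ℂ] E}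
    {C : ℝ} (hB : HilbertSchmidtBound B C)
    (hAB : ∀ x y, inner ℂ x (A y) - inner ℂ (A x) y = 2 * Complex.I * inner ℂ x (B y)) :
    ∃ M : Submodule ℂ E, IsClosed (M : Set E) ∧ (∀ x ∈ M, A x ∈ M) ∧ M ≠ ⊥ ∧ M ≠ ⊤ := by
  by_contra! hcon
  have : Nontrivial E := rank_pos_iff_nontrivial.1 (zero_lt_one.trans hE)
  have hshift (s : ℂ) (M : Submodule ℂ E) (hM : IsClosed (M : Set E))
      (hinv : ∀ x ∈ M, (A - s • 1) x ∈ M) : M = ⊥ ∨ M = ⊤ := by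
    refine or_iff_not_imp_left.2 (hcon M hM fun x hx => ?_)
    have h1 := M.add_mem (hinv x hx) (M.smul_mem s hx)
    simpa using h1
  obtain ⟨s, hs⟩ := exists_hilbertSchmidtBound_sub_smul
    (A := A - (-(‖A‖ : ℂ)) • (1 : E →L[ℂ] E)) hB (fun x y => by
      rw [← hAB]
      simp) (fun x => by
      have h1 : inner ℂ x ((A - (-(‖A‖ : ℂ)) • (1 : E →L[ℂ] E)) x) =
          inner ℂ x (A x) + ((‖A‖ * ‖x‖ ^ 2 : ℝ) : ℂ) := by
        simp
      have h2 := (Complex.abs_re_le_norm _).trans (norm_inner_le_norm (𝕜 := ℂ) x (A x))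
      have h3 := mul_le_mul_of_nonneg_left (A.le_opNorm x) (norm_nonneg x)
      have h4 := neg_le_of_abs_le (h2.trans h3)
      rw [h1, Complex.add_re, Complex.ofReal_re]
      nlinarith) (hshift _)
  obtain ⟨M, hM, hinv, hbot, htop⟩ := hs.isCompactOperator.exists_invariant hE
  rw [sub_sub, ← add_smul] at hinv
  exact (hshift _ M hM hinv).elim hbot htop

end InvariantSubspace

section Compression

variable {H : Type*} [NormedAddCommGroup H] [InnerProductSpace ℂ H]

/-- The compression of `A` to a subspace `K`, as an operator on `K`. -/
noncomputable def Submodule.compress (K : Submodule ℂ H) [K.HasOrthogonalProjection]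
    (A : H →L[ℂ] H) : K →L[ℂ] K :=
  K.orthogonalProjectionOnto ∘L A ∘L K.subtypeL

theorem Submodule.inner_compress (K : Submodule ℂ H) [K.HasOrthogonalProjection]
    (A : H →L[ℂ] H) (x y : K) : inner ℂ x (K.compress A y) = inner ℂ (x : H) (A y) := by
  simp [Submodule.compress]

theorem HilbertSchmidtBound.compress {B : H →L[ℂ] H} {C : ℝ} (hB : HilbertSchmidtBound B C)
    (K : Submodule ℂ H) [K.HasOrthogonalProjection] : HilbertSchmidtBound (K.compress B) C := by
  intro m n f g hf hg
  simp only [Submodule.inner_compress]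
  exact hB m n _ _ (hf.comp_linearIsometry K.subtypeₗᵢ) (hg.comp_linearIsometry K.subtypeₗᵢ)

variable [CompleteSpace H]

theorem exists_intermediate_of_exists_invariant_compress {A : H →L[ℂ] H} {H₁ H₂ : Submodule ℂ H}
    (h₁ : IsClosed (H₁ : Set H)) (h₂ : IsClosed (H₂ : Set H)) (hA₁ : ∀ x ∈ H₁, A x ∈ H₁)
    (hA₂ : ∀ x ∈ H₂, A x ∈ H₂) (hle : H₁ ≤ H₂) {K : Submodule ℂ H}
    [K.HasOrthogonalProjection] (hK : K = H₂ ⊓ H₁ᗮ) {M : Submodule ℂ K}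
    (hM : IsClosed (M : Set K)) (hinv : ∀ x ∈ M, K.compress A x ∈ M) (hbot : M ≠ ⊥) (htop : M ≠ ⊤) :
    ∃ H₃ : Submodule ℂ H, IsClosed (H₃ : Set H) ∧ (∀ x ∈ H₃, A x ∈ H₃) ∧
      H₁ ≤ H₃ ∧ H₃ ≤ H₂ ∧ H₃ ≠ H₁ ∧ H₃ ≠ H₂ := by
  have : CompleteSpace H₁ := h₁.completeSpace_coe
  have hmem (x : H) : x ∈ K ↔ x ∈ H₂ ∧ x ∈ H₁ᗮ := by rw [hK, Submodule.mem_inf]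
  have hproj₁ (x : H) (hx : x ∈ H₁) : K.orthogonalProjectionOnto x = 0 := by
    rw [Submodule.orthogonalProjectionOnto_eq_zero_iff]
    exact fun y hy => H₁.inner_left_of_mem_orthogonal hx ((hmem y).1 hy).2
  have hsub (x : H) (hx : x ∈ H₂) : x - K.orthogonalProjectionOnto x ∈ H₁ := by
    have h3 : x - H₁.orthogonalProjectionOnto x ∈ K := (hmem _).2
      ⟨H₂.sub_mem hx (hle (SetLike.coe_mem _)), H₁.sub_starProjection_mem_orthogonal x⟩
    have h4 : K.orthogonalProjectionOnto x =
        ⟨x - H₁.orthogonalProjectionOnto x, h3⟩ := by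
      have h5 := Submodule.orthogonalProjectionOnto_mem_subspace_eq_self (K := K) ⟨_, h3⟩
      rw [← h5, map_sub, hproj₁ _ (SetLike.coe_mem _), sub_zero]
    rw [h4]
    simp
  refine ⟨H₂ ⊓ M.comap (K.orthogonalProjectionOnto : H →ₗ[ℂ] K),
    h₂.inter (hM.preimage K.orthogonalProjectionOnto.continuous), ?_, ?_, inf_le_left, ?_, ?_⟩
  · rintro x ⟨hx₂, hxM⟩
    refine ⟨hA₂ x hx₂, ?_⟩
    have h3 := hproj₁ _ (hA₁ _ (hsub x hx₂))
    rw [map_sub, map_sub, sub_eq_zero] at h3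
    change K.orthogonalProjectionOnto (A x) ∈ M
    rw [h3]
    exact hinv _ hxM
  · refine fun x hx => ⟨hle hx, ?_⟩
    change K.orthogonalProjectionOnto x ∈ M
    rw [hproj₁ x hx]
    exact M.zero_mem
  · intro heq
    refine hbot ((Submodule.eq_bot_iff _).2 fun x hx => ?_)
    have hx₁ : (x : H) ∈ H₁ := by
      rw [← heq]
      refine ⟨((hmem x).1 x.2).1, ?_⟩
      change K.orthogonalProjectionOnto (x : H) ∈ M
      rwa [Submodule.orthogonalProjectionOnto_mem_subspace_eq_self]
    rw [← Submodule.orthogonalProjectionOnto_mem_subspace_eq_self x, hproj₁ _ hx₁]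
  · intro heq
    refine htop (eq_top_iff.2 fun x _ => ?_)
    have hx₂ : (x : H) ∈ H₂ := ((hmem x).1 x.2).1
    rw [← heq] at hx₂
    have h3 : K.orthogonalProjectionOnto (x : H) ∈ M := hx₂.2
    rwa [Submodule.orthogonalProjectionOnto_mem_subspace_eq_self] at h3

end Compression

/-- Corollary 8.9 (`T₁ ⊂ T`): every operator `A = L + iB` with `L` bounded
self-adjoint and `B` self-adjoint Hilbert–Schmidt on a complex separable
Hilbert space belongs to the class T: between any two closed invariant
subspaces `H₁ ⊆ H₂` with `dim(H₂ ⊖ H₁) > 1` there is a strictly intermediate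
closed invariant subspace. -/
theorem stmt_13 {H : Type*} [NormedAddCommGroup H] [InnerProductSpace ℂ H]
    [CompleteSpace H] [TopologicalSpace.SeparableSpace H]
    (L B : H →L[ℂ] H) (hL : IsSelfAdjoint L) (hB : IsSelfAdjoint B)
    (hHS : ∃ (s : Set H) (e : HilbertBasis s ℂ H), Summable fun i => ‖B (e i)‖ ^ 2)
    (A : H →L[ℂ] H) (hA : A = L + Complex.I • B) :
    ∀ H₁ H₂ : Submodule ℂ H,
      IsClosed (H₁ : Set H) → IsClosed (H₂ : Set H) →
      (∀ x ∈ H₁, A x ∈ H₁) → (∀ x ∈ H₂, A x ∈ H₂) →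
      H₁ ≤ H₂ → 1 < Module.rank ℂ ↥(H₂ ⊓ H₁ᗮ) →
      ∃ H₃ : Submodule ℂ H, IsClosed (H₃ : Set H) ∧ (∀ x ∈ H₃, A x ∈ H₃) ∧
        H₁ ≤ H₃ ∧ H₃ ≤ H₂ ∧ H₃ ≠ H₁ ∧ H₃ ≠ H₂ := by
  intro H₁ H₂ h₁ h₂ hA₁ hA₂ hle hrank
  obtain ⟨_, e, hsum⟩ := hHS
  have : CompleteSpace ↥(H₂ ⊓ H₁ᗮ) := (h₂.inter H₁.isClosed_orthogonal).completeSpace_coe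
  obtain ⟨M, hM, hinv, hbot, htop⟩ :=
    ((hilbertSchmidtBound_of_hilbertBasis e hsum).compress (H₂ ⊓ H₁ᗮ)).exists_invariant
      (A := (H₂ ⊓ H₁ᗮ).compress A) hrank fun x y => by
        rw [← inner_conj_symm ((H₂ ⊓ H₁ᗮ).compress A x), Submodule.inner_compress,
          Submodule.inner_compress, Submodule.inner_compress, inner_conj_symm, hA]
        have hLs : inner ℂ (L x : H) (y : H) = inner ℂ (x : H) (L y) := hL.isSymmetric x y
        have hBs : inner ℂ (B x : H) (y : H) = inner ℂ (x : H) (B y) := hB.isSymmetric x y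
        simp only [add_apply, smul_apply, inner_add_left, inner_add_right, inner_smul_left,
          inner_smul_right, hLs, hBs, Complex.conj_I]
        ring
  exact exists_intermediate_of_exists_invariant_compress h₁ h₂ hA₁ hA₂ hle rfl hM hinv hbot htop
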